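/- arXiv:math/0610862 — 3 statements merged into one kernel-verified Lean document; each statement's English description precedes it below -/
import Mathlib

section
/- (Hammersley–Welsh) For every dimension d ≥ 2 there exists a finite constant λ such that for all n ≥ 1 the number of self-avoiding walks satisfies s_n ≤ κ^n · exp(λ n^{1/2}), where κ is the connective constant of ℤ^d. -/
/-- The number of self-avoiding walks of length `n` on the lattice `ℤ^d`,
starting at the origin. -/
noncomputable def sawCount (d n : ℕ) : ℕ :=
  Nat.card {ω : Fin (n + 1) → (Fin d → ℤ) //
    Function.Injective ω ∧ ω 0 = 0 ∧
    ∀ i : Fin n, (∑ j, |ω i.succ j - ω i.castSucc j|) = 1}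

/-- The connective constant of `ℤ^d`: `κ = lim_{n→∞} s_n^{1/n} = inf_{n≥1} s_n^{1/n}`. -/
noncomputable def connConst (d : ℕ) : ℝ :=
  sInf {x : ℝ | ∃ n : ℕ, 1 ≤ n ∧ x = (sawCount d n : ℝ) ^ ((n : ℝ)⁻¹)}

namespace HW

/-- nearest neighbour relation -/
def Adj {d : ℕ} (x y : Fin d → ℤ) : Prop := (∑ j, |y j - x j|) = 1

/-- self-avoiding walks, extended by a constant after time `n` -/
def SAW (d n : ℕ) : Set (ℕ → (Fin d → ℤ)) :=
  {f | f 0 = 0 ∧ (∀ i, i < n → Adj (f i) (f (i + 1))) ∧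
    (∀ i j, i ≤ n → j ≤ n → f i = f j → i = j) ∧ ∀ i, n ≤ i → f i = f n}

/-- half-space walks with heights at most `A` -/
def HS {d : ℕ} (e : Fin d) (n A : ℕ) : Set (ℕ → (Fin d → ℤ)) :=
  {f | f ∈ SAW d n ∧ (∀ i, 1 ≤ i → i ≤ n → 0 < f i e) ∧ ∀ i, i ≤ n → f i e ≤ A}

/-- bridges -/
def BR {d : ℕ} (e : Fin d) (n : ℕ) : Set (ℕ → (Fin d → ℤ)) :=
  {f | f ∈ SAW d n ∧ (∀ i, 1 ≤ i → i ≤ n → 0 < f i e) ∧ ∀ i, i ≤ n → f i e ≤ f n e}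

/-- bridges of height `A` -/
def BRH {d : ℕ} (e : Fin d) (n A : ℕ) : Set (ℕ → (Fin d → ℤ)) :=
  {f | f ∈ BR e n ∧ f n e = A}

/-- reflection in coordinate `e` -/
def refl {d : ℕ} (e : Fin d) (v : Fin d → ℤ) : Fin d → ℤ := fun j => if j = e then - v j else v j

lemma refl_refl {d : ℕ} (e : Fin d) (v : Fin d → ℤ) : refl e (refl e v) = v := by
  funext j; unfold refl; split_ifs <;> simp

lemma refl_inj {d : ℕ} (e : Fin d) {v w : Fin d → ℤ} (h : refl e v = refl e w) : v = w := by
  rw [← refl_refl e v, h, refl_refl]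

lemma refl_e {d : ℕ} (e : Fin d) (v : Fin d → ℤ) : refl e v e = - v e := by simp [refl]

lemma adj_sub {d : ℕ} {x y : Fin d → ℤ} (c : Fin d → ℤ) (h : Adj x y) : Adj (x - c) (y - c) := by
  unfold Adj at *; simpa using h

lemma adj_add {d : ℕ} {x y : Fin d → ℤ} (c : Fin d → ℤ) (h : Adj x y) : Adj (c + x) (c + y) := by
  unfold Adj at *; simpa using h

lemma adj_symm {d : ℕ} {x y : Fin d → ℤ} (h : Adj x y) : Adj y x := by
  unfold Adj at *; rw [← h]; exact Finset.sum_congr rfl fun j _ => abs_sub_comm _ _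

lemma adj_refl {d : ℕ} {x y : Fin d → ℤ} (e : Fin d) (h : Adj x y) :
    Adj (refl e x) (refl e y) := by
  unfold Adj at *; rw [← h]
  refine Finset.sum_congr rfl fun j _ => ?_
  unfold refl
  split_ifs
  · rw [← abs_neg]; congr 1; ring
  · rfl

lemma adj_single {d : ℕ} (e : Fin d) : Adj 0 (Pi.single e 1 : Fin d → ℤ) := by
  unfold Adj
  rw [Finset.sum_eq_single e]
  · simp
  · intro j _ hj; simp [hj]
  · simp

lemma adj_le {d : ℕ} {x y : Fin d → ℤ} (e : Fin d) (h : Adj x y) : y e ≤ x e + 1 := by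
  have : |y e - x e| ≤ 1 := by
    unfold Adj at h; rw [← h]
    exact Finset.single_le_sum (f := fun j => |y j - x j|) (fun j _ => abs_nonneg _)
      (Finset.mem_univ e)
  have := le_abs_self (y e - x e)
  omega

/-- first part -/
def fstPart {d : ℕ} (m : ℕ) (f : ℕ → (Fin d → ℤ)) : ℕ → (Fin d → ℤ) := fun i => f (min i m)
/-- second part -/
def sndPart {d : ℕ} (m : ℕ) (f : ℕ → (Fin d → ℤ)) : ℕ → (Fin d → ℤ) := fun i => f (m + i) - f m

lemma fst_mem {d m n : ℕ} (hmn : m ≤ n) {f : ℕ → (Fin d → ℤ)} (hf : f ∈ SAW d n) :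
    fstPart m f ∈ SAW d m := by
  obtain ⟨h0, h1, h2, h3⟩ := hf
  refine ⟨by simp [fstPart, h0], ?_, ?_, ?_⟩
  · intro i hi
    have a1 : min i m = i := by omega
    have a2 : min (i + 1) m = i + 1 := by omega
    simp only [fstPart, a1, a2]
    exact h1 i (by omega)
  · intro i j hi hj h
    simp only [fstPart, min_eq_left hi, min_eq_left hj] at h
    exact h2 i j (by omega) (by omega) h
  · intro i hi
    simp [fstPart, hi]

lemma snd_mem {d m n : ℕ} (hmn : m ≤ n) {f : ℕ → (Fin d → ℤ)} (hf : f ∈ SAW d n) :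
    sndPart m f ∈ SAW d (n - m) := by
  obtain ⟨h0, h1, h2, h3⟩ := hf
  refine ⟨by simp [sndPart], ?_, ?_, ?_⟩
  · intro i hi
    exact adj_sub _ (h1 (m + i) (by omega))
  · intro i j hi hj h
    simp only [sndPart, sub_left_inj] at h
    have := h2 _ _ (by omega) (by omega) h
    omega
  · intro i hi
    simp only [sndPart]
    rw [h3 (m + i) (by omega), h3 (m + (n - m)) (by omega)]

lemma refl_mem {d n : ℕ} (e : Fin d) {f : ℕ → (Fin d → ℤ)} (hf : f ∈ SAW d n) :
    (fun i => refl e (f i)) ∈ SAW d n := by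
  obtain ⟨h0, h1, h2, h3⟩ := hf
  refine ⟨?_, fun i hi => adj_refl e (h1 i hi), fun i j hi hj h => h2 i j hi hj (refl_inj e h), ?_⟩
  · funext j; simp [h0, refl]
  · intro i hi; simp [h3 i hi]

lemma parts_inj {d m : ℕ} {f g : ℕ → (Fin d → ℤ)} (h1 : fstPart m f = fstPart m g)
    (h2 : sndPart m f = sndPart m g) : f = g := by
  have hm : f m = g m := by simpa [fstPart] using congrFun h1 m
  funext i
  rcases le_total i m with hi | hi
  · simpa [fstPart, hi] using congrFun h1 i
  · have := congrFun h2 (i - m)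
    simp only [sndPart, hm, sub_left_inj] at this
    rwa [Nat.add_sub_cancel' hi] at this

lemma saw_zero (d : ℕ) : SAW d 0 = {0} := by
  ext f
  simp only [Set.mem_singleton_iff]
  constructor
  · rintro ⟨h0, -, -, h3⟩
    funext i; rw [h3 i (by omega), h0]; rfl
  · rintro rfl
    exact ⟨rfl, by intro i hi; omega, by intro i j hi hj _; omega, by simp⟩

lemma saw_one_finite (d : ℕ) : (SAW d 1).Finite := by
  have hfin : (Set.Icc (fun _ => -1 : Fin d → ℤ) (fun _ => 1)).Finite := Set.finite_Icc _ _
  refine Set.Finite.of_injOn (f := fun f : ℕ → (Fin d → ℤ) => f 1) ?_ ?_ hfin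
  · rintro f ⟨h0, h1, -, -⟩
    have h := h1 0 (by omega)
    have key : ∀ j, |f 1 j| ≤ 1 := by
      intro j
      unfold Adj at h; rw [← h, h0]
      simpa using Finset.single_le_sum (f := fun j => |f 1 j|) (fun j _ => abs_nonneg _)
        (Finset.mem_univ j)
    exact ⟨fun j => (abs_le.1 (key j)).1, fun j => (abs_le.1 (key j)).2⟩
  · rintro f ⟨h0, -, -, h3⟩ g ⟨h0', -, -, h3'⟩ h
    funext i
    rcases Nat.eq_zero_or_pos i with rfl | hi
    · rw [h0, h0']
    · rw [h3 i hi, h3' i hi]; exact h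

lemma saw_split_maps (d m n : ℕ) :
    Set.MapsTo (fun f => (fstPart m f, sndPart m f)) (SAW d (m + n)) (SAW d m ×ˢ SAW d n) := by
  intro f hf
  refine ⟨fst_mem (by omega) hf, ?_⟩
  simpa using snd_mem (m := m) (by omega) hf

lemma saw_split_inj (d m : ℕ) (S : Set (ℕ → (Fin d → ℤ))) :
    Set.InjOn (fun f => (fstPart m f, sndPart m f)) S := by
  intro f _ g _ h
  simp only [Prod.mk.injEq] at h
  exact parts_inj h.1 h.2

lemma saw_finite (d n : ℕ) : (SAW d n).Finite := by
  induction n with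
  | zero => rw [saw_zero]; exact Set.finite_singleton _
  | succ n ih =>
    exact Set.Finite.of_injOn (saw_split_maps d n 1) (saw_split_inj d n _)
      (ih.prod (saw_one_finite d))

lemma saw_submul (d m n : ℕ) :
    (SAW d (m + n)).ncard ≤ (SAW d m).ncard * (SAW d n).ncard := by
  rw [← Set.ncard_prod]
  exact Set.ncard_le_ncard_of_injOn _ (saw_split_maps d m n) (saw_split_inj d m _)
    ((saw_finite d m).prod (saw_finite d n))

lemma saw_pow (d m k : ℕ) : (SAW d (m * k)).ncard ≤ (SAW d m).ncard ^ k := by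
  induction k with
  | zero => simp [saw_zero]
  | succ k ih =>
    rw [Nat.mul_succ, pow_succ]
    exact (saw_submul d _ _).trans (Nat.mul_le_mul_right _ ih)

lemma hs_finite {d : ℕ} (e : Fin d) (n A : ℕ) : (HS e n A).Finite :=
  (saw_finite d n).subset fun _ h => h.1
lemma br_finite {d : ℕ} (e : Fin d) (n : ℕ) : (BR e n).Finite :=
  (saw_finite d n).subset fun _ h => h.1
lemma brh_finite {d : ℕ} (e : Fin d) (n A : ℕ) : (BRH e n A).Finite :=
  (br_finite e n).subset fun _ h => h.1

/-- concatenation -/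
def cat {d : ℕ} (m : ℕ) (p q : ℕ → (Fin d → ℤ)) : ℕ → (Fin d → ℤ) :=
  fun i => if i ≤ m then p i else p m + q (i - m)

lemma br_nonneg {d : ℕ} {e : Fin d} {n : ℕ} {f} (hf : f ∈ BR e n) {i : ℕ} (hi : i ≤ n) :
    0 ≤ f i e := by
  rcases Nat.eq_zero_or_pos i with rfl | h
  · rw [hf.1.1]; simp
  · exact (hf.2.1 i h hi).le

lemma cat_lo {d m : ℕ} {p q : ℕ → (Fin d → ℤ)} {i : ℕ} (hi : i ≤ m) : cat m p q i = p i := by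
  simp [cat, hi]

lemma cat_hi {d m : ℕ} {p q : ℕ → (Fin d → ℤ)} (hq : q 0 = 0) {i : ℕ} (hi : m ≤ i) :
    cat m p q i = p m + q (i - m) := by
  rcases hi.eq_or_lt with rfl | h
  · simp [cat, hq]
  · simp [cat, not_le.2 h]

lemma cat_mem {d : ℕ} {e : Fin d} {m n : ℕ} {p q} (hp : p ∈ BR e m) (hq : q ∈ BR e n) :
    cat m p q ∈ BR e (m + n) := by
  have hp' := hp
  have hq' := hq
  obtain ⟨⟨p0, p1, p2, p3⟩, p4, p5⟩ := hp
  obtain ⟨⟨q0, q1, q2, q3⟩, q4, q5⟩ := hq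
  have last : cat m p q (m + n) = p m + q n := by
    rw [cat_hi q0 (by omega)]; simp
  have pm := br_nonneg hp' le_rfl
  have qn := br_nonneg hq' le_rfl
  have cross : ∀ i j, i ≤ m → m < j → j ≤ m + n → cat m p q i ≠ cat m p q j := by
    intro i j hi hj hj' h
    rw [cat_lo hi, cat_hi q0 hj.le] at h
    have h := congrFun h e
    simp only [Pi.add_apply] at h
    have := p5 i hi
    have := q4 (j - m) (by omega) (by omega)
    omega
  refine ⟨⟨?_, ?_, ?_, ?_⟩, ?_, ?_⟩
  · rw [cat_lo (by omega), p0]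
  · intro i hi
    by_cases h : i < m
    · rw [cat_lo h.le, cat_lo (by omega)]; exact p1 i h
    · rw [cat_hi q0 (by omega), cat_hi q0 (by omega), show i + 1 - m = i - m + 1 by omega]
      exact adj_add _ (q1 _ (by omega))
  · intro i j hi hj h
    by_cases h1 : i ≤ m <;> by_cases h2 : j ≤ m
    · rw [cat_lo h1, cat_lo h2] at h; exact p2 i j h1 h2 h
    · exact absurd h (cross i j h1 (by omega) hj)
    · exact absurd h.symm (cross j i h2 (by omega) hi)
    · rw [cat_hi q0 (by omega), cat_hi q0 (by omega)] at h
      have := q2 _ _ (by omega) (by omega) (add_left_cancel h)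
      omega
  · intro i hi
    rw [last, cat_hi q0 (by omega), q3 (i - m) (by omega)]
  · intro i hi hi'
    by_cases h : i ≤ m
    · rw [cat_lo h]; exact p4 i hi h
    · rw [cat_hi q0 (by omega)]
      have := q4 (i - m) (by omega) (by omega)
      simp only [Pi.add_apply]; omega
  · intro i hi
    rw [last]
    simp only [Pi.add_apply]
    by_cases h : i ≤ m
    · rw [cat_lo h]; have := p5 i h; omega
    · rw [cat_hi q0 (by omega)]
      have := q5 (i - m) (by omega)
      simp only [Pi.add_apply]; omega

lemma br_supermul {d : ℕ} (e : Fin d) (m n : ℕ) :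
    (BR e m).ncard * (BR e n).ncard ≤ (BR e (m + n)).ncard := by
  rw [← Set.ncard_prod]
  refine Set.ncard_le_ncard_of_injOn (fun x => cat m x.1 x.2) (fun x hx => cat_mem hx.1 hx.2) ?_
    (br_finite e _)
  rintro ⟨p, q⟩ ⟨hp, hq⟩ ⟨p', q'⟩ ⟨hp', hq'⟩ h
  simp only at h hp hq hp' hq'
  have lo : ∀ i, i ≤ m → p i = p' i := by
    intro i hi
    have := congrFun h i
    rwa [cat_lo hi, cat_lo hi] at this
  have e1 : p = p' := by
    funext i
    rcases le_total i m with hi | hi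
    · exact lo i hi
    · rw [hp.1.2.2.2 i hi, hp'.1.2.2.2 i hi, lo m le_rfl]
  have e2 : q = q' := by
    funext i
    have := congrFun h (m + i)
    rw [cat_hi hq.1.1 (by omega), cat_hi hq'.1.1 (by omega), lo m le_rfl] at this
    simpa using this
  rw [e1, e2]

lemma br_zero {d : ℕ} (e : Fin d) : BR e 0 = {0} := by
  ext f
  constructor
  · intro h; rw [← saw_zero]; exact h.1
  · intro h
    have hf : f = 0 := h
    rw [← saw_zero] at h
    subst hf
    exact ⟨h, by intro i _ _; omega, by simp⟩

lemma br_pow {d : ℕ} (e : Fin d) (m k : ℕ) : (BR e m).ncard ^ k ≤ (BR e (m * k)).ncard := by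
  induction k with
  | zero => simp [br_zero]
  | succ k ih =>
    rw [Nat.mul_succ, pow_succ]
    exact (Nat.mul_le_mul_right _ ih).trans (br_supermul e _ _)

lemma br_one_pos {d : ℕ} (e : Fin d) : 1 ≤ (BR e 1).ncard := by
  rw [Nat.one_le_iff_ne_zero, ← Nat.pos_iff_ne_zero, Set.ncard_pos (br_finite e 1)]
  refine ⟨fun i => if i = 0 then 0 else Pi.single e 1, ⟨by simp, ?_, ?_, ?_⟩, ?_, ?_⟩
  · intro i hi
    obtain rfl : i = 0 := by omega
    simpa using adj_single e
  · intro i j hi hj h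
    have h := congrFun h e
    interval_cases i <;> interval_cases j <;> simp at h ⊢
  · intro i hi
    simp [show i ≠ 0 by omega]
  · intro i hi _
    simp [show i ≠ 0 by omega]
  · intro i hi
    interval_cases i <;> simp

lemma br_le_saw {d : ℕ} (e : Fin d) (n : ℕ) : (BR e n).ncard ≤ (SAW d n).ncard :=
  Set.ncard_le_ncard (fun _ h => h.1) (saw_finite d n)

/-- comparison of the two models of walks -/
lemma sawCount_eq (d n : ℕ) : sawCount d n = (SAW d n).ncard := by
  unfold sawCount
  rw [← Nat.card_coe_set_eq]
  refine Nat.card_congr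
    { toFun := fun w => ⟨fun i => w.1 ⟨min i n, by omega⟩, ?_⟩
      invFun := fun f => ⟨fun i => f.1 i, ?_⟩
      left_inv := ?_
      right_inv := ?_ }
  · obtain ⟨w, h1, h2, h3⟩ := w
    refine ⟨by simpa using h2, ?_, ?_, ?_⟩
    · intro i hi
      have := h3 ⟨i, hi⟩
      have a1 : min i n = i := by omega
      have a2 : min (i + 1) n = i + 1 := by omega
      simp only [a1, a2]
      exact this
    · intro i j hi hj h
      have := h1 h
      simp only [Fin.mk.injEq] at this
      omega
    · intro i hi
      simp [hi]
  · obtain ⟨f, h0, h1, h2, h3⟩ := f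
    refine ⟨?_, by simpa using h0, ?_⟩
    · intro i j h
      exact Fin.ext (h2 i j (by omega) (by omega) h)
    · intro i
      exact h1 i i.2
  · rintro ⟨w, h1, h2, h3⟩
    apply Subtype.ext
    funext i
    simp only
    congr 1
    apply Fin.ext
    simp only
    omega
  · rintro ⟨f, h0, h1, h2, h3⟩
    apply Subtype.ext
    funext i
    simp only
    rcases le_total i n with hi | hi
    · simp [hi]
    · simp [hi, h3 i hi]

lemma conn_nonneg (d : ℕ) : 0 ≤ connConst d := by
  apply Real.sInf_nonneg
  rintro x ⟨n, -, rfl⟩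
  positivity

lemma br_le_conn {d : ℕ} (e : Fin d) (n : ℕ) : ((BR e n).ncard : ℝ) ≤ connConst d ^ n := by
  rcases Nat.eq_zero_or_pos n with rfl | hn
  · simp [br_zero]
  have key : ((BR e n).ncard : ℝ) ^ ((n : ℝ)⁻¹) ≤ connConst d := by
    apply le_csInf
    · exact ⟨_, 1, le_rfl, rfl⟩
    rintro x ⟨m, hm, rfl⟩
    rw [sawCount_eq]
    have h : (BR e n).ncard ^ m ≤ (SAW d m).ncard ^ n := by
      calc _ ≤ (BR e (n * m)).ncard := br_pow e n m
        _ ≤ (SAW d (n * m)).ncard := br_le_saw e _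
        _ ≤ _ := by rw [mul_comm]; exact saw_pow d m n
    have h' : ((BR e n).ncard : ℝ) ^ m ≤ ((SAW d m).ncard : ℝ) ^ n := by exact_mod_cast h
    have hn' : (n : ℝ) ≠ 0 := by positivity
    have hm' : (m : ℝ) ≠ 0 := by positivity
    have h2 := Real.rpow_le_rpow (by positivity) h'
      (show (0 : ℝ) ≤ (m : ℝ)⁻¹ * (n : ℝ)⁻¹ by positivity)
    rw [← Real.rpow_natCast, ← Real.rpow_natCast, ← Real.rpow_mul (by positivity),
      ← Real.rpow_mul (by positivity)] at h2
    rw [show (m : ℝ) * ((m : ℝ)⁻¹ * (n : ℝ)⁻¹) = (n : ℝ)⁻¹ by field_simp,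
      show (n : ℝ) * ((m : ℝ)⁻¹ * (n : ℝ)⁻¹) = (m : ℝ)⁻¹ by field_simp] at h2
    exact h2
  have := pow_le_pow_left₀ (by positivity) key n
  rwa [Real.rpow_inv_natCast_pow (by positivity) (by omega)] at this

lemma one_le_conn {d : ℕ} (e : Fin d) : 1 ≤ connConst d := by
  have h := br_le_conn e 1
  have h1 : (1 : ℝ) ≤ ((BR e 1).ncard : ℝ) := by exact_mod_cast br_one_pos e
  simpa using h1.trans h

/-- peeling off the first bridge of a half-space walk -/
lemma hs_rec {d : ℕ} (e : Fin d) (n A : ℕ) :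
    (HS e n (A + 1)).ncard ≤ (HS e n A).ncard +
      ∑ m ∈ Finset.range (n + 1), (BRH e m (A + 1)).ncard * (HS e (n - m) A).ncard := by
  classical
  let T : ℕ → Set (ℕ → (Fin d → ℤ)) := fun m =>
    {f | f ∈ HS e n (A + 1) ∧ f m e = A + 1 ∧ ∀ i, m < i → i ≤ n → f i e < A + 1}
  have hT : ∀ m, (T m).Finite := fun m => (hs_finite e n (A + 1)).subset fun _ h => h.1
  have hsub : HS e n (A + 1) ⊆ HS e n A ∪ ⋃ m ∈ Finset.range (n + 1), T m := by
    intro f hf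
    by_cases h : ∃ i, i ≤ n ∧ f i e = A + 1
    · right
      obtain ⟨i, hi, hi'⟩ := h
      have hs := Nat.findGreatest_spec (P := fun i => f i e = A + 1) hi hi'
      simp only [Set.mem_iUnion]
      refine ⟨Nat.findGreatest (fun i => f i e = A + 1) n, ?_, hf, hs, ?_⟩
      · rw [Finset.mem_range]; exact Nat.lt_succ_of_le (Nat.findGreatest_le _)
      · intro j hj hj'
        have h1 := Nat.findGreatest_is_greatest hj hj'
        have h2 := hf.2.2 j hj'
        push_cast at h2
        exact lt_of_le_of_ne h2 h1
    · left
      refine ⟨hf.1, hf.2.1, fun i hi => ?_⟩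
      have h2 := hf.2.2 i hi
      push_cast at h2
      have : f i e ≠ A + 1 := fun h' => h ⟨i, hi, h'⟩
      omega
  have hTm : ∀ m ∈ Finset.range (n + 1),
      (T m).ncard ≤ (BRH e m (A + 1)).ncard * (HS e (n - m) A).ncard := by
    intro m hm
    have hm : m ≤ n := by rw [Finset.mem_range] at hm; omega
    rw [← Set.ncard_prod]
    refine Set.ncard_le_ncard_of_injOn
      (fun f => (fstPart m f, fun i => refl e (sndPart m f i))) ?_ ?_
      ((brh_finite e _ _).prod (hs_finite e _ _))
    · rintro f ⟨⟨hf, hf1, hf2⟩, hf3, hf4⟩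
      refine ⟨⟨⟨fst_mem hm hf, ?_, ?_⟩, ?_⟩, refl_mem e (snd_mem hm hf), ?_, ?_⟩
      · intro i hi hi'
        simp only [fstPart, min_eq_left hi']
        exact hf1 i hi (by omega)
      · intro i hi
        simp only [fstPart, min_eq_left hi, min_self, hf3]
        have := hf2 i (by omega)
        push_cast at this; exact this
      · simp [fstPart, hf3]
      · intro i hi hi'
        simp only [refl_e]
        simp only [sndPart, Pi.sub_apply, hf3]
        have := hf4 (m + i) (by omega) (by omega)
        omega
      · intro i hi
        simp only [refl_e]
        simp only [sndPart, Pi.sub_apply, hf3]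
        rcases Nat.eq_zero_or_pos i with rfl | h
        · rw [Nat.add_zero, hf3]; omega
        · have := hf1 (m + i) (by omega) (by omega)
          omega
    · intro f _ g _ h
      simp only [Prod.mk.injEq] at h
      refine parts_inj h.1 ?_
      funext i
      exact refl_inj e (congrFun h.2 i)
  have hfin : (HS e n A ∪ ⋃ m ∈ Finset.range (n + 1), T m).Finite :=
    (hs_finite e n A).union (Set.Finite.biUnion (Finset.finite_toSet _) fun m _ => hT m)
  calc _ ≤ (HS e n A ∪ ⋃ m ∈ Finset.range (n + 1), T m).ncard := Set.ncard_le_ncard hsub hfin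
    _ ≤ (HS e n A).ncard + (⋃ m ∈ Finset.range (n + 1), T m).ncard := Set.ncard_union_le _ _
    _ ≤ (HS e n A).ncard + ∑ m ∈ Finset.range (n + 1), (T m).ncard :=
        Nat.add_le_add_left (Finset.set_ncard_biUnion_le _ _) _
    _ ≤ _ := Nat.add_le_add_left (Finset.sum_le_sum hTm) _

lemma hs_zero_zero {d : ℕ} (e : Fin d) : (HS e 0 0).ncard ≤ 1 := by
  have : HS e 0 0 ⊆ {0} := by
    intro f h; rw [← saw_zero]; exact h.1
  simpa using Set.ncard_le_ncard this

lemma hs_succ_zero {d : ℕ} (e : Fin d) (n : ℕ) : (HS e (n + 1) 0).ncard = 0 := by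
  have : HS e (n + 1) 0 = ∅ := by
    ext f
    simp only [Set.mem_empty_iff_false, iff_false]
    intro h
    have h1 := h.2.1 1 le_rfl (by omega)
    have h2 := h.2.2 1 (by omega)
    simp at h2; omega
  simp [this]

/-- splitting a walk at its last lowest point -/
lemma saw_le {d : ℕ} (e : Fin d) (n : ℕ) :
    (SAW d n).ncard ≤ ∑ m ∈ Finset.range (n + 1),
      (HS e (m + 1) (n + 1)).ncard * (HS e (n - m) (n + 1)).ncard := by
  classical
  have hbd : ∀ (k : ℕ) (f : ℕ → (Fin d → ℤ)), f ∈ SAW d k → ∀ i, i ≤ k → f i e ≤ i := by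
    intro k f hf i
    induction i with
    | zero => intro _; rw [hf.1]; simp
    | succ i ih =>
      intro hi
      have h1 := ih (by omega)
      have h2 := adj_le e (hf.2.1 i (by omega))
      push_cast; omega
  have hHS : ∀ (k : ℕ) (f : ℕ → (Fin d → ℤ)), k ≤ n + 1 → f ∈ SAW d k →
      (∀ i, 1 ≤ i → i ≤ k → 0 < f i e) → f ∈ HS e k (n + 1) := by
    intro k f hk hf hpos
    refine ⟨hf, hpos, fun i hi => ?_⟩
    have := hbd k f hf i hi
    push_cast; omega
  let T : ℕ → Set (ℕ → (Fin d → ℤ)) := fun m =>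
    {f | f ∈ SAW d n ∧ (∀ i, i ≤ n → f m e ≤ f i e) ∧ ∀ i, m < i → i ≤ n → f m e < f i e}
  have hT : ∀ m, (T m).Finite := fun m => (saw_finite d n).subset fun _ h => h.1
  have hsub : SAW d n ⊆ ⋃ m ∈ Finset.range (n + 1), T m := by
    intro f hf
    obtain ⟨k, hk, hk'⟩ := Finset.exists_min_image (Finset.range (n + 1)) (fun i => f i e)
      ⟨0, by simp⟩
    simp only [Finset.mem_range, Nat.lt_succ_iff] at hk hk'
    have hs := Nat.findGreatest_spec (P := fun i => f i e = f k e) hk rfl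
    simp only [Set.mem_iUnion]
    refine ⟨Nat.findGreatest (fun i => f i e = f k e) n, ?_, hf, ?_, ?_⟩
    · rw [Finset.mem_range]; exact Nat.lt_succ_of_le (Nat.findGreatest_le _)
    · intro i hi; rw [hs]; exact hk' i hi
    · intro i hi hi'
      rw [hs]
      exact lt_of_le_of_ne (hk' i hi') (Ne.symm (Nat.findGreatest_is_greatest hi hi'))
  have hTm : ∀ m ∈ Finset.range (n + 1),
      (T m).ncard ≤ (HS e (m + 1) (n + 1)).ncard * (HS e (n - m) (n + 1)).ncard := by
    intro m hm
    have hm : m ≤ n := by rw [Finset.mem_range] at hm; omega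
    rw [← Set.ncard_prod]
    let g : (ℕ → (Fin d → ℤ)) → (ℕ → (Fin d → ℤ)) := fun f i =>
      if i = 0 then 0 else Pi.single e 1 + (f (m - (i - 1)) - f m)
    have gs : ∀ f i, g f (i + 1) = Pi.single e 1 + (f (m - i) - f m) := by
      intro f i; simp [g]
    have g0 : ∀ f, g f 0 = 0 := by intro f; simp [g]
    refine Set.ncard_le_ncard_of_injOn
      (fun f => (g f, sndPart m f)) ?_ ?_ ((hs_finite e _ _).prod (hs_finite e _ _))
    · rintro f ⟨hf, hmin, hlast⟩
      have gpos : ∀ i, 1 ≤ i → i ≤ m + 1 → 0 < g f i e := by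
        intro i hi hi'
        obtain ⟨i, rfl⟩ : ∃ k, i = k + 1 := ⟨i - 1, by omega⟩
        rw [gs]
        have := hmin (m - i) (by omega)
        simp; omega
      have gsaw : g f ∈ SAW d (m + 1) := by
        refine ⟨g0 f, ?_, ?_, ?_⟩
        · intro i hi
          rcases Nat.eq_zero_or_pos i with rfl | h
          · rw [g0, gs]; simpa using adj_single e
          · obtain ⟨i, rfl⟩ : ∃ k, i = k + 1 := ⟨i - 1, by omega⟩
            rw [gs, gs]
            apply adj_add
            apply adj_sub
            have := hf.2.1 (m - (i + 1)) (by omega)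
            rw [show m - (i + 1) + 1 = m - i by omega] at this
            exact adj_symm this
        · intro i j hi hj h
          rcases Nat.eq_zero_or_pos i with rfl | h1 <;> rcases Nat.eq_zero_or_pos j with rfl | h2
          · rfl
          · have := gpos j h2 hj
            rw [← h, g0] at this; simp at this
          · have := gpos i h1 hi
            rw [h, g0] at this; simp at this
          · obtain ⟨i, rfl⟩ : ∃ k, i = k + 1 := ⟨i - 1, by omega⟩
            obtain ⟨j, rfl⟩ : ∃ k, j = k + 1 := ⟨j - 1, by omega⟩
            rw [gs, gs] at h
            have h := sub_left_injective (add_left_cancel h)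
            have := hf.2.2.1 _ _ (by omega) (by omega) h
            omega
        · intro i hi
          obtain ⟨i, rfl⟩ : ∃ k, i = k + 1 := ⟨i - 1, by omega⟩
          rw [gs, gs, show m - i = m - m by omega]
      refine ⟨hHS _ _ (by omega) gsaw gpos, hHS _ _ (by omega) (snd_mem hm hf) ?_⟩
      · intro i hi hi'
        simp only [sndPart, Pi.sub_apply]
        have := hlast (m + i) (by omega) (by omega)
        omega
    · rintro f ⟨hf, -, -⟩ f' ⟨hf', -, -⟩ h
      simp only [Prod.mk.injEq] at h
      obtain ⟨h1, h2⟩ := h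
      have k1 : ∀ i, f (m - i) - f m = f' (m - i) - f' m := by
        intro i
        have := congrFun h1 (i + 1)
        rw [gs, gs] at this
        exact add_left_cancel this
      have k2 : f m = f' m := by
        have := k1 m
        simpa [hf.1, hf'.1] using this
      refine parts_inj (m := m) ?_ h2
      funext i
      have := k1 (m - min i m)
      rw [k2, show m - (m - min i m) = min i m by omega] at this
      exact sub_left_injective this
  have hfin : (⋃ m ∈ Finset.range (n + 1), T m).Finite :=
    (Set.Finite.biUnion (Finset.finite_toSet _) fun m _ => hT m)
  calc _ ≤ (⋃ m ∈ Finset.range (n + 1), T m).ncard := Set.ncard_le_ncard hsub hfin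
    _ ≤ ∑ m ∈ Finset.range (n + 1), (T m).ncard := Finset.set_ncard_biUnion_le _ _
    _ ≤ _ := Finset.sum_le_sum hTm

/-- truncated generating function of half-space walks -/
noncomputable def G {d : ℕ} (e : Fin d) (N A : ℕ) (z : ℝ) : ℝ :=
  ∑ n ∈ Finset.range (N + 1), ((HS e n A).ncard : ℝ) * z ^ n
/-- truncated generating function of bridges of height `A` -/
noncomputable def Bg {d : ℕ} (e : Fin d) (N A : ℕ) (z : ℝ) : ℝ :=
  ∑ n ∈ Finset.range (N + 1), ((BRH e n A).ncard : ℝ) * z ^ n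

lemma G_nonneg {d : ℕ} (e : Fin d) (N A : ℕ) {z : ℝ} (hz : 0 ≤ z) : 0 ≤ G e N A z :=
  Finset.sum_nonneg fun _ _ => by positivity

lemma G_rec {d : ℕ} (e : Fin d) (N A : ℕ) {z : ℝ} (hz : 0 ≤ z) :
    G e N (A + 1) z ≤ G e N A z * (1 + Bg e N (A + 1) z) := by
  have h1 : ∀ n, ((HS e n (A + 1)).ncard : ℝ) * z ^ n ≤ ((HS e n A).ncard : ℝ) * z ^ n +
      ∑ m ∈ Finset.range (n + 1), (((BRH e m (A + 1)).ncard : ℝ) * z ^ m) *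
        (((HS e (n - m) A).ncard : ℝ) * z ^ (n - m)) := by
    intro n
    have h : ((HS e n (A + 1)).ncard : ℝ) ≤ (HS e n A).ncard +
      ∑ m ∈ Finset.range (n + 1), ((BRH e m (A + 1)).ncard : ℝ) * (HS e (n - m) A).ncard := by
      exact_mod_cast hs_rec e n A
    refine (mul_le_mul_of_nonneg_right h (pow_nonneg hz n)).trans (le_of_eq ?_)
    rw [add_mul, Finset.sum_mul]
    congr 1
    refine Finset.sum_congr rfl fun m hm => ?_
    rw [Finset.mem_range] at hm
    have : z ^ n = z ^ m * z ^ (n - m) := by rw [← pow_add]; congr 1; omega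
    rw [this]; ring
  have h2 : ∑ n ∈ Finset.range (N + 1), ∑ m ∈ Finset.range (n + 1),
      (((BRH e m (A + 1)).ncard : ℝ) * z ^ m) * (((HS e (n - m) A).ncard : ℝ) * z ^ (n - m))
      ≤ Bg e N (A + 1) z * G e N A z := by
    unfold Bg G
    rw [Finset.sum_mul_sum]
    have hsw : ∑ n ∈ Finset.range (N + 1), ∑ m ∈ Finset.range (n + 1),
        (((BRH e m (A + 1)).ncard : ℝ) * z ^ m) * (((HS e (n - m) A).ncard : ℝ) * z ^ (n - m))
        = ∑ m ∈ Finset.range (N + 1), ∑ k ∈ Finset.range (N + 1 - m),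
        (((BRH e m (A + 1)).ncard : ℝ) * z ^ m) * (((HS e k A).ncard : ℝ) * z ^ k) :=
      Finset.sum_range_diag_flip (N + 1) fun m k =>
        (((BRH e m (A + 1)).ncard : ℝ) * z ^ m) * (((HS e k A).ncard : ℝ) * z ^ k)
    rw [hsw]
    refine Finset.sum_le_sum fun m _ => ?_
    refine Finset.sum_le_sum_of_subset_of_nonneg ?_ fun _ _ _ => by positivity
    exact Finset.range_subset_range.2 (by omega)
  unfold G at *
  calc _ ≤ _ := Finset.sum_le_sum fun n _ => h1 n
    _ ≤ _ := by rw [Finset.sum_add_distrib]; linarith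

lemma brh_sum {d : ℕ} (e : Fin d) (n A : ℕ) :
    ∑ a ∈ Finset.range A, (BRH e n (a + 1)).ncard ≤ (BR e n).ncard := by
  classical
  have : ∀ a, (BRH e n (a + 1)).ncard =
      ((br_finite e n).toFinset.filter fun f => f n e = ((a + 1 : ℕ) : ℤ)).card := by
    intro a
    rw [← Set.ncard_coe_finset]
    congr 1
    ext f
    simp [BRH]
  simp only [this]
  rw [← Finset.card_biUnion]
  · rw [Set.ncard_eq_toFinset_card _ (br_finite e n)]
    apply Finset.card_le_card
    intro f
    simp only [Finset.mem_biUnion, Finset.mem_filter]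
    rintro ⟨a, -, h, -⟩
    exact h
  · intro a _ b _ hab
    simp only [Function.onFun]
    rw [Finset.disjoint_left]
    intro f h1 h2
    rw [Finset.mem_filter] at h1 h2
    have := h1.2.symm.trans h2.2
    apply hab
    omega

lemma G_le {d : ℕ} (e : Fin d) (N A : ℕ) {z : ℝ} (hz : 0 ≤ z) :
    G e N A z ≤ Real.exp (∑ a ∈ Finset.range A, Bg e N (a + 1) z) := by
  induction A with
  | zero =>
    unfold G
    rw [Finset.sum_range_succ']
    have := hs_zero_zero e
    simp only [hs_succ_zero]
    simpa using this
  | succ A ih =>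
    rw [Finset.sum_range_succ, Real.exp_add]
    refine (G_rec e N A hz).trans ?_
    have h1 : 1 + Bg e N (A + 1) z ≤ Real.exp (Bg e N (A + 1) z) := by
      have := Real.add_one_le_exp (Bg e N (A + 1) z); linarith
    exact (mul_le_mul_of_nonneg_left h1 (G_nonneg e N A hz)).trans
      (mul_le_mul_of_nonneg_right ih (Real.exp_pos _).le)

lemma hs_bound {d : ℕ} (e : Fin d) (N A n : ℕ) (hN : 1 ≤ N) (hn : n ≤ N) :
    ((HS e n A).ncard : ℝ) ≤ connConst d ^ n * Real.exp (1 + 2 * Real.sqrt N) := by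
  have hκ := one_le_conn e
  set κ := connConst d with hκd
  set s := Real.sqrt N with hs
  have hs1 : 1 ≤ s := by rw [hs, Real.one_le_sqrt]; exact_mod_cast hN
  have hs0 : 0 < s := by linarith
  have hss : s * s = N := Real.mul_self_sqrt (by positivity)
  set x : ℝ := s / (s + 1) with hx
  have hx0 : 0 < x := by positivity
  have hx1 : x < 1 := by rw [hx, div_lt_one (by linarith)]; linarith
  have hκ0 : 0 < κ := by linarith
  set z : ℝ := x / κ with hz
  have hz0 : 0 < z := by positivity
  have hB : ∑ a ∈ Finset.range A, Bg e N (a + 1) z ≤ 1 + s := by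
    unfold Bg
    rw [Finset.sum_comm]
    calc _ ≤ ∑ m ∈ Finset.range (N + 1), x ^ m := by
          refine Finset.sum_le_sum fun m _ => ?_
          rw [← Finset.sum_mul]
          have h1 : (∑ a ∈ Finset.range A, ((BRH e m (a + 1)).ncard : ℝ)) ≤ κ ^ m := by
            refine le_trans ?_ (br_le_conn e m)
            exact_mod_cast brh_sum e m A
          calc _ ≤ κ ^ m * z ^ m := mul_le_mul_of_nonneg_right h1 (by positivity)
            _ = x ^ m := by rw [← mul_pow, hz, mul_div_cancel₀ _ hκ0.ne']
      _ ≤ (1 - x)⁻¹ := by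
          rw [← tsum_geometric_of_lt_one hx0.le hx1]
          exact (summable_geometric_of_lt_one hx0.le hx1).sum_le_tsum _ fun _ _ => by positivity
      _ = 1 + s := by
          rw [hx]; field_simp; ring
  have h1 : ((HS e n A).ncard : ℝ) * z ^ n ≤ Real.exp (1 + s) := by
    refine le_trans ?_ ((G_le e N A hz0.le).trans (Real.exp_le_exp.2 hB))
    unfold G
    exact Finset.single_le_sum (f := fun n => ((HS e n A).ncard : ℝ) * z ^ n)
      (fun _ _ => by positivity) (Finset.mem_range.2 (by omega))
  have h2 : (x⁻¹) ^ n ≤ Real.exp s := by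
    have : x⁻¹ ≤ Real.exp (1 / s) := by
      have := Real.add_one_le_exp (1 / s)
      refine le_trans (le_of_eq ?_) this
      rw [hx]; field_simp; ring
    calc (x⁻¹) ^ n ≤ (Real.exp (1 / s)) ^ n := pow_le_pow_left₀ (by positivity) this n
      _ = Real.exp (n * (1 / s)) := by rw [← Real.exp_nat_mul]
      _ ≤ Real.exp s := by
        apply Real.exp_le_exp.2
        rw [mul_one_div, div_le_iff₀ hs0, hss]
        exact_mod_cast hn
  have h3 : ((HS e n A).ncard : ℝ) = (((HS e n A).ncard : ℝ) * z ^ n) * (κ ^ n * (x⁻¹) ^ n) := by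
    rw [mul_assoc, ← mul_pow, ← mul_pow, hz]
    rw [show x / κ * (κ * x⁻¹) = 1 by field_simp]
    simp
  rw [h3]
  calc _ ≤ Real.exp (1 + s) * (κ ^ n * Real.exp s) := by gcongr
    _ = κ ^ n * Real.exp (1 + 2 * s) := by
      rw [show 1 + 2 * s = (1 + s) + s by ring, Real.exp_add (1 + s) s]; ring

end HW

/-- (Hammersley–Welsh) For every `d ≥ 2` there is a finite constant `λ` such that
`s_n ≤ κ^n · exp(λ n^{1/2})` for all `n ≥ 1`. -/
theorem hammersley_welsh (d : ℕ) (hd : 2 ≤ d) :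
    ∃ lam : ℝ, ∀ n : ℕ, 1 ≤ n →
      (sawCount d n : ℝ) ≤ connConst d ^ n * Real.exp (lam * Real.sqrt n) := by
  have e : Fin d := ⟨0, by omega⟩
  refine ⟨connConst d + 14, fun n hn => ?_⟩
  have hκ := HW.one_le_conn e
  set κ := connConst d with hκd
  have hκ0 : 0 < κ := by linarith
  set s := Real.sqrt n with hs
  have hn' : (1 : ℝ) ≤ n := by exact_mod_cast hn
  have hs1 : 1 ≤ s := by rw [hs, Real.one_le_sqrt]; exact hn'
  have hss : s * s = n := Real.mul_self_sqrt (by positivity)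
  have hS : Real.sqrt ((n + 1 : ℕ) : ℝ) ≤ 2 * s := by
    rw [Real.sqrt_le_left (by linarith)]
    push_cast
    nlinarith
  set E := Real.exp (1 + 4 * s) with hE
  have hH : ∀ k, k ≤ n + 1 → ((HW.HS e k (n + 1)).ncard : ℝ) ≤ κ ^ k * E := by
    intro k hk
    refine (HW.hs_bound e (n + 1) (n + 1) k (by omega) hk).trans ?_
    refine mul_le_mul_of_nonneg_left (Real.exp_le_exp.2 ?_) (by positivity)
    linarith
  have h1 : (sawCount d n : ℝ) ≤ ∑ m ∈ Finset.range (n + 1),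
      ((HW.HS e (m + 1) (n + 1)).ncard : ℝ) * ((HW.HS e (n - m) (n + 1)).ncard : ℝ) := by
    rw [HW.sawCount_eq]
    exact_mod_cast HW.saw_le e n
  have h2 : ∀ m ∈ Finset.range (n + 1),
      ((HW.HS e (m + 1) (n + 1)).ncard : ℝ) * ((HW.HS e (n - m) (n + 1)).ncard : ℝ)
        ≤ κ ^ (n + 1) * (E * E) := by
    intro m hm
    rw [Finset.mem_range] at hm
    calc _ ≤ (κ ^ (m + 1) * E) * (κ ^ (n - m) * E) := by
          refine mul_le_mul (hH _ (by omega)) (hH _ (by omega)) (by positivity) (by positivity)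
      _ = κ ^ ((m + 1) + (n - m)) * (E * E) := by rw [pow_add]; ring
      _ = _ := by rw [show (m + 1) + (n - m) = n + 1 by omega]
  have h3 := h1.trans (Finset.sum_le_sum h2)
  rw [Finset.sum_const, Finset.card_range, nsmul_eq_mul] at h3
  have hk : κ ≤ Real.exp (κ * s) := by
    have := Real.add_one_le_exp (κ * s)
    nlinarith
  have hnn : ((n + 1 : ℕ) : ℝ) ≤ Real.exp (2 * s) := by
    have := Real.add_one_le_exp s
    have h' : Real.exp (2 * s) = Real.exp s * Real.exp s := by rw [← Real.exp_add]; ring_nf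
    rw [h']
    push_cast
    nlinarith
  have hEE : E * E ≤ Real.exp (10 * s) := by
    rw [hE, ← Real.exp_add]
    apply Real.exp_le_exp.2
    linarith
  calc (sawCount d n : ℝ) ≤ ((n + 1 : ℕ) : ℝ) * (κ ^ (n + 1) * (E * E)) := h3
    _ = κ ^ n * (κ * ((n + 1 : ℕ) : ℝ) * (E * E)) := by ring
    _ ≤ κ ^ n * (Real.exp (κ * s) * Real.exp (2 * s) * Real.exp (10 * s)) := by gcongr
    _ = κ ^ n * Real.exp ((κ + 12) * s) := by
        rw [← Real.exp_add, ← Real.exp_add]; ring_nf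
    _ ≤ κ ^ n * Real.exp ((κ + 14) * s) := by
        gcongr; linarith
end

section
/- (Temperley–Fisher, Kasteleyn) The two-dimensional dimer entropy equals Catalan's constant divided by π: if f(m,n) is the number of perfect matchings of the m × n grid graph, then (mn)^{-1} log f(m,n) → G/π as m, n → ∞ through values with mn even, where G = ∑_{k=0}^{∞} (−1)^k / (2k+1)² is Catalan's constant. -/
open Filter

/-- The number of perfect matchings of the `m × n` grid graph (equivalently,
domino tilings of an `m × n` rectangle): fixed-point-free involutions matching
each cell to a cell at `ℓ¹`-distance `1`. -/
noncomputable def gridMatchCount (m n : ℕ) : ℕ :=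
  Nat.card {f : Fin m × Fin n → Fin m × Fin n //
    Function.Involutive f ∧
    ∀ x, |((x.1 : ℤ)) - (((f x).1 : ℤ))| + |((x.2 : ℤ)) - (((f x).2 : ℤ))| = 1}


set_option linter.unusedSectionVars false

noncomputable def pmc {α : Type} (adj : α → α → Prop) (P : α → Prop) : ℕ :=
  Nat.card {f : α → α // Function.Involutive f ∧ ∀ x, (P x → adj x (f x)) ∧ (¬ P x → f x = x)}

section pm
variable {α : Type} [Fintype α] [DecidableEq α] {adj : α → α → Prop}

theorem pmc_congr {P Q : α → Prop} (h : ∀ x, P x ↔ Q x) : pmc adj P = pmc adj Q := by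
  have : P = Q := funext fun x => propext (h x)
  rw [this]

theorem pmc_empty {P : α → Prop} (h : ∀ x, ¬ P x) : pmc adj P = 1 := by
  unfold pmc
  rw [Nat.card_eq_one_iff_unique]
  refine ⟨⟨?_⟩, ⟨⟨id, fun x => rfl, fun x => ⟨fun hx => absurd hx (h x), fun _ => rfl⟩⟩⟩⟩
  rintro ⟨f, hf, hf'⟩ ⟨g, hg, hg'⟩
  apply Subtype.ext
  funext x
  show f x = g x
  rw [(hf' x).2 (h x), (hg' x).2 (h x)]

/-- matchings in which `p` is matched with `q` -/
theorem pmc_fiber (hsymm : ∀ x y, adj x y → adj y x) (hirr : ∀ x, ¬ adj x x) {P : α → Prop} {p q : α}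
    (hp : P p) (hq : P q) (hpq : adj p q) :
    Nat.card {f : α → α // (Function.Involutive f ∧
      ∀ x, (P x → adj x (f x)) ∧ (¬ P x → f x = x)) ∧ f p = q} =
    pmc adj (fun x => P x ∧ x ≠ p ∧ x ≠ q) := by
  have hne : p ≠ q := fun h => hirr p (by rw [← h] at hpq; exact hpq)
  unfold pmc
  refine Nat.card_congr ⟨fun f => ⟨fun x => if x = p then p else if x = q then q else f.1 x, ?_⟩,
    fun f => ⟨fun x => if x = p then q else if x = q then p else f.1 x, ?_⟩, ?_, ?_⟩
  · obtain ⟨f, ⟨hf, hf'⟩, hfp⟩ := f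
    have hfq : f q = p := by rw [← hfp, hf p]
    refine ⟨fun x => ?_, fun x => ?_⟩
    · by_cases h1 : x = p
      · simp [h1]
      by_cases h2 : x = q
      · simp [h2, hne.symm]
      have h3 : f x ≠ p := fun h => h2 (by rw [← hf x, h, hfp])
      have h4 : f x ≠ q := fun h => h1 (by rw [← hf x, h, hfq])
      simp [h1, h2, h3, h4, hf x]
    · by_cases h1 : x = p
      · simp [h1]
      by_cases h2 : x = q
      · simp [h2, hne.symm]
      simpa [h1, h2] using hf' x
  · obtain ⟨f, hf, hf'⟩ := f
    have hfp : f p = p := (hf' p).2 (by simp)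
    have hfq : f q = q := (hf' q).2 (by simp)
    refine ⟨⟨fun x => ?_, fun x => ?_⟩, by simp⟩
    · by_cases h1 : x = p
      · simp [h1, hne.symm]
      by_cases h2 : x = q
      · simp [h2, hne.symm]
      have h3 : f x ≠ p := fun h => h1 (by rw [← hf x, h, hfp])
      have h4 : f x ≠ q := fun h => h2 (by rw [← hf x, h, hfq])
      simp [h1, h2, h3, h4, hf x]
    · by_cases h1 : x = p
      · subst h1; simp [hp, hpq]
      by_cases h2 : x = q
      · subst h2; simp [hq, h1, hsymm _ _ hpq]
      simpa [h1, h2] using hf' x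
  · rintro ⟨f, ⟨hf, hf'⟩, hfp⟩
    have hfq : f q = p := by rw [← hfp, hf p]
    apply Subtype.ext; funext x
    by_cases h1 : x = p
    · simp [h1, hfp]
    by_cases h2 : x = q
    · simp [h2, hne.symm, hfq]
    simp [h1, h2]
  · rintro ⟨f, hf, hf'⟩
    have hfp : f p = p := (hf' p).2 (by simp)
    have hfq : f q = q := (hf' q).2 (by simp)
    apply Subtype.ext; funext x
    by_cases h1 : x = p
    · simp [h1, hfp]
    by_cases h2 : x = q
    · simp [h2, hne.symm, hfq]
    simp [h1, h2]

open Classical in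
theorem pmc_rec (hsymm : ∀ x y, adj x y → adj y x) (hirr : ∀ x, ¬ adj x x) {P : α → Prop} {p : α}
    (hP : ∀ x y, adj x y → ¬ P y → P x → ∀ f : α → α, Function.Involutive f →
      (∀ x, (P x → adj x (f x)) ∧ (¬ P x → f x = x)) → f x ≠ y)
    (hp : P p) :
    pmc adj P = ∑ q : α, if P q ∧ adj p q then pmc adj (fun x => P x ∧ x ≠ p ∧ x ≠ q) else 0 := by
  have e : {f : α → α // Function.Involutive f ∧ ∀ x, (P x → adj x (f x)) ∧ (¬ P x → f x = x)} ≃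
    Σ q : α, {f : α → α // (Function.Involutive f ∧
      ∀ x, (P x → adj x (f x)) ∧ (¬ P x → f x = x)) ∧ f p = q} :=
    ⟨fun f => ⟨f.1 p, ⟨f.1, f.2, rfl⟩⟩, fun f => ⟨f.2.1, f.2.2.1⟩, fun f => rfl,
      by rintro ⟨q, f, hf, rfl⟩; rfl⟩
  rw [pmc, Nat.card_congr e, Nat.card_sigma]
  refine Finset.sum_congr rfl fun q _ => ?_
  split_ifs with h
  · exact pmc_fiber hsymm hirr hp h.1 h.2
  · rw [Nat.card_eq_zero]
    left
    refine ⟨?_⟩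
    rintro ⟨f, ⟨hf, hf'⟩, hfp⟩
    have hadj : adj p q := hfp ▸ (hf' p).1 hp
    by_cases hq : P q
    · exact h ⟨hq, hadj⟩
    · exact hP p q hadj hq hp f hf hf' hfp

theorem pmc_rec' (hsymm : ∀ x y, adj x y → adj y x) (hirr : ∀ x, ¬ adj x x) {P : α → Prop} {p : α}
    (hp : P p) [DecidablePred fun q => P q ∧ adj p q] :
    pmc adj P = ∑ q : α, if P q ∧ adj p q then pmc adj (fun x => P x ∧ x ≠ p ∧ x ≠ q) else 0 := by
  rw [pmc_rec hsymm hirr (p := p) ?_ hp]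
  · refine Finset.sum_congr rfl fun q _ => ?_
    congr
  · intro x y hxy hy hx f hf hf' h
    have h1 : f y = x := by rw [← h, hf x]
    have h2 : f y = y := (hf' y).2 hy
    exact hirr x (by rw [← h1.symm.trans h2] at hxy; exact hxy)

theorem pmc_two (hsymm : ∀ x y, adj x y → adj y x) (hirr : ∀ x, ¬ adj x x) {P : α → Prop} {p q r : α}
    (hp : P p) (hqr : q ≠ r) (hq : P q ∧ adj p q) (hr : P r ∧ adj p r)
    (hall : ∀ x, P x → adj p x → x = q ∨ x = r) :
    pmc adj P = pmc adj (fun x => P x ∧ x ≠ p ∧ x ≠ q) + pmc adj (fun x => P x ∧ x ≠ p ∧ x ≠ r) := by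
  classical
  rw [pmc_rec' hsymm hirr hp, Finset.sum_eq_add q r hqr]
  · rw [if_pos hq, if_pos hr]
  · intro c _ hc
    rw [if_neg]
    intro h
    rcases hall c h.1 h.2 with h | h
    · exact hc.1 h
    · exact hc.2 h
  · simp
  · simp

theorem pmc_one (hsymm : ∀ x y, adj x y → adj y x) (hirr : ∀ x, ¬ adj x x) {P : α → Prop} {p q : α}
    (hp : P p) (hq : P q ∧ adj p q)
    (hall : ∀ x, P x → adj p x → x = q) :
    pmc adj P = pmc adj (fun x => P x ∧ x ≠ p ∧ x ≠ q) := by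
  classical
  rw [pmc_rec' hsymm hirr hp, Finset.sum_eq_single q]
  · rw [if_pos hq]
  · intro c _ hc
    rw [if_neg]
    intro h
    exact hc (hall c h.1 h.2)
  · simp

theorem pmc_zero (hsymm : ∀ x y, adj x y → adj y x) (hirr : ∀ x, ¬ adj x x) {P : α → Prop} {p : α}
    (hp : P p) (hall : ∀ x, P x → ¬ adj p x) :
    pmc adj P = 0 := by
  classical
  rw [pmc_rec' hsymm hirr hp]
  apply Finset.sum_eq_zero
  intro c _
  rw [if_neg]
  intro h
  exact hall c h.1 h.2
end pm



def gadj (m n : ℕ) (x y : Fin m × Fin n) : Prop :=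
  |((x.1 : ℤ)) - ((y.1 : ℤ))| + |((x.2 : ℤ)) - ((y.2 : ℤ))| = 1

theorem gadj_symm (m n : ℕ) : ∀ x y, gadj m n x y → gadj m n y x := by
  intro x y h
  unfold gadj at *
  rw [abs_sub_comm, abs_sub_comm (y.2 : ℤ)]
  exact h

theorem gadj_irr (m n : ℕ) : ∀ x, ¬ gadj m n x x := by
  intro x h
  simp [gadj] at h

theorem gadj_iff {m n : ℕ} (x y : Fin m × Fin n) : gadj m n x y ↔
    ((x.1 : ℕ) = y.1 ∧ ((x.2 : ℕ) + 1 = y.2 ∨ (y.2 : ℕ) + 1 = x.2)) ∨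
    ((x.2 : ℕ) = y.2 ∧ ((x.1 : ℕ) + 1 = y.1 ∨ (y.1 : ℕ) + 1 = x.1)) := by
  unfold gadj
  rcases abs_cases ((x.1 : ℤ) - (y.1 : ℤ)) with ⟨h1, _⟩ | ⟨h1, _⟩ <;>
  rcases abs_cases ((x.2 : ℤ) - (y.2 : ℤ)) with ⟨h2, _⟩ | ⟨h2, _⟩ <;>
  rw [h1, h2] <;> omega

/-- cells not yet covered, in state `(i,j)` with particle configuration `X` -/
def remc (m n κ i j : ℕ) (X : Finset (Fin n)) (x : Fin m × Fin n) : Prop :=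
  i + (if (x.2 : ℕ) < j then 1 else 0) < x.1 ∨
   ((x.1 : ℕ) = i + (if (x.2 : ℕ) < j then 1 else 0) ∧ (x.2 ∈ X ↔ ((x.1 : ℕ) + x.2 + κ) % 2 = 1))

def okc (m n κ i j : ℕ) (X : Finset (Fin n)) : Prop :=
  ∀ c : Fin n, i + (if (c : ℕ) < j then 1 else 0) = m → (c ∈ X ↔ (m + (c : ℕ) + κ) % 2 = 1)

open Classical in
noncomputable def Zc (m n κ i j : ℕ) (X : Finset (Fin n)) : ℕ :=
  if okc m n κ i j X then pmc (gadj m n) (remc m n κ i j X) else 0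

theorem okc_lt {m n κ i j : ℕ} {X : Finset (Fin n)} (h : i + 1 < m) : okc m n κ i j X := by
  intro c hc
  split_ifs at hc <;> omega

theorem Zc_absent {m n κ i j : ℕ} {X : Finset (Fin n)} (hi : i < m) (hj : j < n)
    (h : ¬ ((⟨j, hj⟩ : Fin n) ∈ X ↔ (i + j + κ) % 2 = 1)) :
    Zc m n κ i j X = Zc m n κ i (j + 1) X := by
  have h1 : okc m n κ i j X ↔ okc m n κ i (j + 1) X := by
    unfold okc
    refine forall_congr' fun c => ?_
    by_cases hc : (c : ℕ) = j
    · obtain rfl : c = ⟨j, hj⟩ := Fin.ext hc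
      by_cases hX : (⟨j, hj⟩ : Fin n) ∈ X <;> simp [hX] at h ⊢ <;> omega
    · have : (c : ℕ) < j + 1 ↔ (c : ℕ) < j := by omega
      simp [this]
  have h2 : ∀ x, remc m n κ i j X x ↔ remc m n κ i (j + 1) X x := by
    rintro ⟨⟨r, hr⟩, c, hcn⟩
    unfold remc
    by_cases hc : c = j
    · subst hc
      by_cases hX : (⟨c, hj⟩ : Fin n) ∈ X <;> simp [hX] at h ⊢ <;> omega
    · have : c < j + 1 ↔ c < j := by omega
      simp [this]
  unfold Zc
  rw [pmc_congr h2]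
  by_cases h3 : okc m n κ i j X
  · rw [if_pos h3, if_pos (h1.1 h3)]
  · rw [if_neg h3, if_neg (fun h => h3 (h1.2 h))]

/-- removing a vertical domino -/
theorem remc_down {m n κ i j : ℕ} {X : Finset (Fin n)} (hi : i + 1 < m) (hj : j < n)
    (h : ((⟨j, hj⟩ : Fin n) ∈ X ↔ (i + j + κ) % 2 = 1)) (x : Fin m × Fin n) :
    (remc m n κ i j X x ∧ x ≠ (⟨i, by omega⟩, ⟨j, hj⟩) ∧ x ≠ (⟨i + 1, hi⟩, ⟨j, hj⟩)) ↔
      remc m n κ i (j + 1) X x := by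
  obtain ⟨⟨r, hr⟩, c, hcn⟩ := x
  unfold remc
  by_cases hc : c = j
  · subst hc
    by_cases hX : (⟨c, hj⟩ : Fin n) ∈ X <;> simp [hX] at h ⊢ <;> omega
  · have : c < j + 1 ↔ c < j := by omega
    simp [this, hc]

/-- removing a horizontal domino -/
theorem remc_right {m n κ i j : ℕ} {X X' : Finset (Fin n)} (hi : i < m) (hj : j + 1 < n)
    (h : ((⟨j, by omega⟩ : Fin n) ∈ X ↔ (i + j + κ) % 2 = 1))
    (h' : ((⟨j + 1, hj⟩ : Fin n) ∈ X ↔ (i + (j + 1) + κ) % 2 = 1))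
    (hX' : ∀ c : Fin n, c ∈ X' ↔ if (c : ℕ) = j ∨ (c : ℕ) = j + 1 then c ∉ X else c ∈ X)
    (x : Fin m × Fin n) :
    (remc m n κ i j X x ∧ x ≠ (⟨i, by omega⟩, ⟨j, by omega⟩) ∧ x ≠ (⟨i, hi⟩, ⟨j + 1, hj⟩)) ↔
      remc m n κ i (j + 1) X' x := by
  obtain ⟨⟨r, hr⟩, c, hcn⟩ := x
  unfold remc
  simp only [hX']
  by_cases hc : c = j
  · subst hc
    by_cases hX : (⟨c, hcn⟩ : Fin n) ∈ X <;> simp [hX] at h ⊢ <;> omega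
  by_cases hc : c = j + 1
  · subst hc
    by_cases hX : (⟨j + 1, hj⟩ : Fin n) ∈ X <;> simp [hX] at h' ⊢ <;> omega
  · have : c < j + 1 ↔ c < j := by omega
    simp [this, *]

theorem Zc_present {m n κ i j : ℕ} {X : Finset (Fin n)} (hi : i < m) (hj : j < n)
    (h : ((⟨j, hj⟩ : Fin n) ∈ X ↔ (i + j + κ) % 2 = 1))
    (h' : ∀ hj1 : j + 1 < n, ¬ ((⟨j + 1, hj1⟩ : Fin n) ∈ X ↔ (i + (j + 1) + κ) % 2 = 1)) :
    Zc m n κ i j X = Zc m n κ i (j + 1) X := by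
  have hp : remc m n κ i j X (⟨i, hi⟩, ⟨j, hj⟩) := by
    right; simpa using h
  have hnb : ∀ x, remc m n κ i j X x → gadj m n (⟨i, hi⟩, ⟨j, hj⟩) x →
      (x.1 : ℕ) = i + 1 ∧ (x.2 : ℕ) = j := by
    rintro ⟨⟨r, hr⟩, c, hcn⟩ hx hadj
    rw [gadj_iff] at hadj
    simp only [remc] at hx hadj ⊢
    rcases hadj with ⟨rfl, rfl | rfl⟩ | ⟨rfl, rfl | rfl⟩
    · have := h' hcn
      simp at hx
      exact absurd hx this
    · simp at hx
    · simp
    · simp at hx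
  by_cases him : i + 1 < m
  · unfold Zc
    rw [if_pos (okc_lt him), if_pos (okc_lt him), pmc_one (gadj_symm m n) (gadj_irr m n)
      (p := (⟨i, hi⟩, ⟨j, hj⟩)) (q := (⟨i + 1, him⟩, ⟨j, hj⟩)) hp]
    · exact pmc_congr (remc_down him hj h)
    · constructor
      · left; simp
      · simp [gadj]
    · intro x hx hadj
      have := hnb x hx hadj
      ext <;> simp [this]
  · have h0 : ¬ okc m n κ i (j + 1) X := by
      intro hok
      have := hok ⟨j, hj⟩ (by simp; omega)
      rw [h] at this
      simp at this
      omega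
    unfold Zc
    rw [if_neg h0, pmc_zero (gadj_symm m n) (gadj_irr m n) hp]
    · simp
    · intro x hx hadj
      have := hnb x hx hadj
      have := x.1.2
      omega

theorem Zc_both {m n κ i j : ℕ} {X X' : Finset (Fin n)} (hi : i < m) (hj : j + 1 < n)
    (h : ((⟨j, by omega⟩ : Fin n) ∈ X ↔ (i + j + κ) % 2 = 1))
    (h' : ((⟨j + 1, hj⟩ : Fin n) ∈ X ↔ (i + (j + 1) + κ) % 2 = 1))
    (hX' : ∀ c : Fin n, c ∈ X' ↔ if (c : ℕ) = j ∨ (c : ℕ) = j + 1 then c ∉ X else c ∈ X) :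
    Zc m n κ i j X = Zc m n κ i (j + 1) X + Zc m n κ i (j + 1) X' := by
  have hj0 : j < n := by omega
  have hp : remc m n κ i j X (⟨i, hi⟩, ⟨j, hj0⟩) := by
    right; simpa using h
  have hq : remc m n κ i j X (⟨i, hi⟩, ⟨j + 1, hj⟩) ∧
      gadj m n (⟨i, hi⟩, ⟨j, hj0⟩) (⟨i, hi⟩, ⟨j + 1, hj⟩) := by
    constructor
    · right; simpa using h'
    · simp [gadj]
  have hnb : ∀ x, remc m n κ i j X x → gadj m n (⟨i, hi⟩, ⟨j, hj0⟩) x →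
      ((x.1 : ℕ) = i ∧ (x.2 : ℕ) = j + 1) ∨ ((x.1 : ℕ) = i + 1 ∧ (x.2 : ℕ) = j) := by
    rintro ⟨⟨r, hr⟩, c, hcn⟩ hx hadj
    rw [gadj_iff] at hadj
    simp only [remc] at hx hadj ⊢
    rcases hadj with ⟨rfl, rfl | rfl⟩ | ⟨rfl, rfl | rfl⟩
    · simp
    · simp at hx
    · simp
    · simp at hx
  by_cases him : i + 1 < m
  · unfold Zc
    rw [if_pos (okc_lt him), if_pos (okc_lt him), if_pos (okc_lt him),
      pmc_two (gadj_symm m n) (gadj_irr m n)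
      (p := (⟨i, hi⟩, ⟨j, hj0⟩)) (q := (⟨i + 1, him⟩, ⟨j, hj0⟩)) (r := (⟨i, hi⟩, ⟨j + 1, hj⟩)) hp _ _ hq]
    · rw [pmc_congr (remc_down him hj0 h), pmc_congr (remc_right hi hj h h' hX')]
    · intro x hx hadj
      rcases hnb x hx hadj with this | this
      · right; ext <;> simp [this]
      · left; ext <;> simp [this]
    · simp
    · constructor
      · left; simp
      · simp [gadj]
  · have h0 : ¬ okc m n κ i (j + 1) X := by
      intro hok
      have := hok ⟨j, hj0⟩ (by simp; omega)
      rw [h] at this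
      simp at this
      omega
    have h1 : okc m n κ i j X ↔ okc m n κ i (j + 1) X' := by
      unfold okc
      refine forall_congr' fun c => ?_
      rw [hX']
      by_cases hc : (c : ℕ) = j
      · obtain rfl : c = ⟨j, hj0⟩ := Fin.ext hc
        by_cases hX : (⟨j, hj0⟩ : Fin n) ∈ X <;> simp [hX] at h ⊢ <;> omega
      by_cases hc' : (c : ℕ) = j + 1
      · obtain rfl : c = ⟨j + 1, hj⟩ := Fin.ext hc'
        simp; omega
      · have : (c : ℕ) < j + 1 ↔ (c : ℕ) < j := by omega
        simp [this, hc, hc']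
    unfold Zc
    rw [if_neg h0, pmc_one (gadj_symm m n) (gadj_irr m n)
      (p := (⟨i, hi⟩, ⟨j, hj0⟩)) (q := (⟨i, hi⟩, ⟨j + 1, hj⟩)) hp hq]
    · rw [pmc_congr (remc_right hi hj h h' hX')]
      by_cases h3 : okc m n κ i j X
      · rw [if_pos h3, if_pos (h1.1 h3), zero_add]
      · rw [if_neg h3, if_neg (fun h => h3 (h1.2 h))]
    · intro x hx hadj
      rcases hnb x hx hadj with this | this
      · ext <;> simp [this]
      · have := x.1.2
        omega

theorem Zc_next_row {m n κ i : ℕ} {X : Finset (Fin n)} :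
    Zc m n κ i n X = Zc m n κ (i + 1) 0 X := by
  unfold Zc
  have h1 : okc m n κ i n X ↔ okc m n κ (i + 1) 0 X := by
    unfold okc; simp
  have h2 : ∀ x, remc m n κ i n X x ↔ remc m n κ (i + 1) 0 X x := by
    intro x; unfold remc; simp
  rw [pmc_congr h2]
  by_cases h3 : okc m n κ i n X
  · rw [if_pos h3, if_pos (h1.1 h3)]
  · rw [if_neg h3, if_neg (fun h => h3 (h1.2 h))]

/-- columns of odd colour -/
def X0 (n κ : ℕ) : Finset (Fin n) := Finset.univ.filter fun c => ((c : ℕ) + κ) % 2 = 1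

theorem Zc_end {m n κ : ℕ} (hm : Even m) {X : Finset (Fin n)} :
    Zc m n κ m 0 X = if X = X0 n κ then 1 else 0 := by
  have h1 : okc m n κ m 0 X ↔ X = X0 n κ := by
    obtain ⟨t, rfl⟩ := hm
    unfold okc X0
    rw [Finset.ext_iff]
    refine forall_congr' fun c => ?_
    simp
    have : (t + t + (c : ℕ) + κ) % 2 = (c + κ) % 2 := by omega
    rw [this]
  unfold Zc
  rw [pmc_empty]
  · by_cases h3 : okc m n κ m 0 X
    · rw [if_pos h3, if_pos (h1.1 h3)]
    · rw [if_neg h3, if_neg (fun h => h3 (h1.2 h))]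
  · intro x hx
    have := x.1.2
    simp [remc] at hx
    omega

theorem Zc_start {m n κ : ℕ} (hm : 0 < m) :
    Zc m n κ 0 0 (X0 n κ) = gridMatchCount m n := by
  unfold Zc
  rw [if_pos]
  · unfold pmc gridMatchCount
    have h2 : ∀ x, remc m n κ 0 0 (X0 n κ) x := by
      intro x; unfold remc X0; simp
      by_cases hx : x.1 = (⟨0, hm⟩ : Fin m)
      · right; simp [hx]
      · left
        have : (x.1 : ℕ) ≠ 0 := fun h => hx (Fin.ext h)
        omega
    simp only [h2, not_true, false_imp_iff, true_imp_iff, and_true]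
    rfl
  · intro c hc
    simp at hc
    omega


section minors
variable {n k : ℕ}

theorem emb_swap {X X' : Finset (Fin n)} (h : X.card = k) (h' : X'.card = k) {a b : Fin n}
    (hab : (a : ℕ) + 1 = b ∨ (b : ℕ) + 1 = a) (ha : a ∉ X) {i0 : Fin k}
    (hi : X.orderEmbOfFin h i0 = b) (hX' : X' = insert a (X.erase b)) :
    (X'.orderEmbOfFin h' : Fin k → Fin n) = Function.update (X.orderEmbOfFin h) i0 a := by
  symm
  apply Finset.orderEmbOfFin_unique
  · intro i
    by_cases hii : i = i0
    · subst hii; simp [hX']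
    · rw [Function.update_of_ne hii, hX']
      refine Finset.mem_insert_of_mem (Finset.mem_erase.2 ⟨?_, Finset.orderEmbOfFin_mem _ _ _⟩)
      rw [← hi]
      exact fun h0 => hii ((X.orderEmbOfFin h).injective h0)
  · intro i j hij
    have hlt : X.orderEmbOfFin h i < X.orderEmbOfFin h j := (X.orderEmbOfFin h).strictMono hij
    have hne : ∀ l, (X.orderEmbOfFin h l : ℕ) ≠ a := by
      intro l hl
      apply ha
      rw [← Fin.ext hl]
      exact Finset.orderEmbOfFin_mem _ _ _
    have h1 := hne i
    have h2 := hne j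
    by_cases hii : i = i0
    · subst hii
      rw [Function.update_self, Function.update_of_ne hij.ne']
      rw [hi] at hlt
      rw [Fin.lt_def] at hlt ⊢
      omega
    · by_cases hjj : j = i0
      · subst hjj
        rw [Function.update_self, Function.update_of_ne hij.ne]
        rw [hi] at hlt
        rw [Fin.lt_def] at hlt ⊢
        omega
      · rwa [Function.update_of_ne hii, Function.update_of_ne hjj]

theorem minor_not_mem {M : Matrix (Fin n) (Fin n) ℝ} {y : Fin k → Fin n} {X : Finset (Fin n)}
    (h : X.card = k) {b : Fin n} {v : Fin n → ℝ} (hb : b ∉ X) :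
    ((M.updateRow b v).submatrix (X.orderEmbOfFin h) y).det =
      (M.submatrix (X.orderEmbOfFin h) y).det := by
  congr 1
  ext i j
  have : X.orderEmbOfFin h i ≠ b := fun h0 => hb (h0 ▸ Finset.orderEmbOfFin_mem _ _ _)
  simp [Matrix.updateRow_ne this]

theorem minor_aux {M : Matrix (Fin n) (Fin n) ℝ} {y : Fin k → Fin n} {x : Fin k → Fin n}
    (hx : Function.Injective x) {a : Fin n} {i0 : Fin k} :
    ((M.updateRow (x i0) (M (x i0) + M a)).submatrix x y).det =
      (M.submatrix x y).det + (M.submatrix (Function.update x i0 a) y).det := by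
  have e1 : (M.updateRow (x i0) (M (x i0) + M a)).submatrix x y =
      (M.submatrix x y).updateRow i0 ((M.submatrix x y) i0 + fun j => M a (y j)) := by
    ext i j
    by_cases hi : i = i0
    · subst hi; simp
    · have : x i ≠ x i0 := fun h => hi (hx h)
      simp [Matrix.updateRow_ne hi, Matrix.updateRow_ne this]
  have e2 : M.submatrix (Function.update x i0 a) y =
      (M.submatrix x y).updateRow i0 (fun j => M a (y j)) := by
    ext i j
    by_cases hi : i = i0
    · subst hi; simp
    · simp [Matrix.updateRow_ne hi, Function.update_of_ne hi]
  rw [e1, e2, Matrix.det_updateRow_add, Matrix.updateRow_eq_self]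

theorem minor_both {M : Matrix (Fin n) (Fin n) ℝ} {y : Fin k → Fin n} {X : Finset (Fin n)}
    (h : X.card = k) {a b : Fin n} (hab : a ≠ b) (hb : b ∈ X) (ha : a ∈ X) :
    ((M.updateRow b (M b + M a)).submatrix (X.orderEmbOfFin h) y).det =
      (M.submatrix (X.orderEmbOfFin h) y).det := by
  obtain ⟨i0, rfl⟩ : b ∈ Set.range (X.orderEmbOfFin h) := by rw [Finset.range_orderEmbOfFin]; exact hb
  obtain ⟨i1, rfl⟩ : a ∈ Set.range (X.orderEmbOfFin h) := by rw [Finset.range_orderEmbOfFin]; exact ha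
  have hne : i1 ≠ i0 := fun h => hab (by rw [h])
  rw [minor_aux (X.orderEmbOfFin h).injective, add_eq_left]
  apply Matrix.det_zero_of_row_eq hne
  funext j
  simp [Function.update_of_ne hne]

theorem minor_move {M : Matrix (Fin n) (Fin n) ℝ} {y : Fin k → Fin n} {X X' : Finset (Fin n)}
    (h : X.card = k) (h' : X'.card = k) {a b : Fin n} (hab : (a : ℕ) + 1 = b ∨ (b : ℕ) + 1 = a)
    (hb : b ∈ X) (ha : a ∉ X) (hX' : X' = insert a (X.erase b)) :
    ((M.updateRow b (M b + M a)).submatrix (X.orderEmbOfFin h) y).det =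
      (M.submatrix (X.orderEmbOfFin h) y).det + (M.submatrix (X'.orderEmbOfFin h') y).det := by
  obtain ⟨i0, hi0⟩ : b ∈ Set.range (X.orderEmbOfFin h) := by rw [Finset.range_orderEmbOfFin]; exact hb
  rw [emb_swap h h' hab ha hi0 hX', ← hi0]
  exact minor_aux (X.orderEmbOfFin h).injective

end minors

def DimRep (m n κ i j : ℕ) (M : Matrix (Fin n) (Fin n) ℝ) : Prop :=
  ∀ (X : Finset (Fin n)) (h : X.card = (X0 n κ).card), (Zc m n κ i j X : ℝ) =
    (M.submatrix (X.orderEmbOfFin h) ((X0 n κ).orderEmbOfFin rfl)).det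

/-- partial row transfer matrix -/
def gmat (n s j : ℕ) : Matrix (Fin n) (Fin n) ℝ := Matrix.of fun r c =>
  (if r = c then 1 else 0) +
  if ((r : ℕ) + s) % 2 = 1 ∧ ((r : ℕ) + 1 = c ∨ (c : ℕ) + 1 = r) ∧ j ≤ r ∧ j ≤ c then 1 else 0

theorem rep_step {m n κ i j : ℕ} (hi : i < m) {M : Matrix (Fin n) (Fin n) ℝ} {a b : Fin n}
    (hab : ((a : ℕ) = j ∧ (b : ℕ) = j + 1) ∨ ((b : ℕ) = j ∧ (a : ℕ) = j + 1))
    (hb : ((b : ℕ) + (i + κ)) % 2 = 1)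
    (hM : DimRep m n κ i (j + 1) M) : DimRep m n κ i j (M.updateRow b (M b + M a)) := by
  intro X h
  have hj : j < n := by have := a.2; have := b.2; omega
  have hj1 : j + 1 < n := by have := a.2; have := b.2; omega
  have hab' : (a : ℕ) + 1 = b ∨ (b : ℕ) + 1 = a := by omega
  have hne : a ≠ b := fun h => by rw [h] at hab'; omega
  by_cases hbX : b ∈ X
  · by_cases haX : a ∈ X
    · rw [minor_both h hne hbX haX, ← hM X h]
      congr 1
      rcases hab with ⟨h1, h2⟩ | ⟨h1, h2⟩
      · obtain rfl : a = ⟨j, hj⟩ := Fin.ext h1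
        apply Zc_absent hi hj
        simp [haX]; omega
      · obtain rfl : a = ⟨j + 1, hj1⟩ := Fin.ext h2
        obtain rfl : b = ⟨j, hj⟩ := Fin.ext h1
        apply Zc_present hi hj
        · simp only [hbX, true_iff]; simp at hb; omega
        · intro _; simp [haX]; simp at hb; omega
    · have hcard : (insert a (X.erase b)).card = (X0 n κ).card := by
        rw [Finset.card_insert_of_notMem (fun h => haX (Finset.mem_of_mem_erase h)),
          Finset.card_erase_add_one hbX, h]
      rw [minor_move h hcard hab' hbX haX rfl, ← hM X h, ← hM _ hcard, ← Nat.cast_add]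
      congr 1
      apply Zc_both hi hj1
      · rcases hab with ⟨h1, h2⟩ | ⟨h1, h2⟩
        · obtain rfl : a = ⟨j, hj⟩ := Fin.ext h1
          simp [haX]; omega
        · obtain rfl : b = ⟨j, hj⟩ := Fin.ext h1
          simp only [hbX, true_iff]; simp at hb; omega
      · rcases hab with ⟨h1, h2⟩ | ⟨h1, h2⟩
        · obtain rfl : b = ⟨j + 1, hj1⟩ := Fin.ext h2
          simp only [hbX, true_iff]; simp at hb; omega
        · obtain rfl : a = ⟨j + 1, hj1⟩ := Fin.ext h2
          simp [haX]; omega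
      · intro c
        by_cases hca : c = a
        · subst hca
          rw [if_pos (by omega)]; simp [haX]
        by_cases hcb : c = b
        · subst hcb
          rw [if_pos (by omega)]; simp [hbX, hca]
        · have h1 : (c : ℕ) ≠ a := fun h => hca (Fin.ext h)
          have h2 : (c : ℕ) ≠ b := fun h => hcb (Fin.ext h)
          rw [if_neg (by omega)]
          simp [hca, hcb]
  · rw [minor_not_mem h hbX, ← hM X h]
    congr 1
    rcases hab with ⟨h1, h2⟩ | ⟨h1, h2⟩
    · obtain rfl : b = ⟨j + 1, hj1⟩ := Fin.ext h2
      obtain rfl : a = ⟨j, hj⟩ := Fin.ext h1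
      by_cases haX : (⟨j, hj⟩ : Fin n) ∈ X
      · apply Zc_absent hi hj
        simp [haX]; simp at hb; omega
      · apply Zc_present hi hj
        · simp [haX]; simp at hb; omega
        · intro _; simp [hbX]; simp at hb; omega
    · obtain rfl : b = ⟨j, hj⟩ := Fin.ext h1
      apply Zc_absent hi hj
      simp [hbX]; simp at hb; omega

theorem gmat_update {n s j : ℕ} {a b : Fin n}
    (hab : ((a : ℕ) = j ∧ (b : ℕ) = j + 1) ∨ ((b : ℕ) = j ∧ (a : ℕ) = j + 1))
    (hb : ((b : ℕ) + s) % 2 = 1) :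
    gmat n s j = (gmat n s (j + 1)).updateRow b (gmat n s (j + 1) b + gmat n s (j + 1) a) := by
  ext r c
  by_cases hr : r = b
  · subst hr
    rw [Matrix.updateRow_self]
    have h1 : (if a = c then (1:ℝ) else 0) = if (a : ℕ) = c then 1 else 0 := by simp [Fin.ext_iff]
    simp only [gmat, Matrix.of_apply, Pi.add_apply, h1, add_assoc, add_right_inj]
    rw [if_neg (c := ((a : ℕ) + s) % 2 = 1 ∧ _) (by omega), add_zero]
    split_ifs <;> first | omega | norm_num
  · rw [Matrix.updateRow_ne hr]
    simp only [gmat, Matrix.of_apply, add_right_inj]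
    have h2 : (r : ℕ) ≠ b := fun h => hr (Fin.ext h)
    congr 1
    rw [eq_iff_iff]
    omega

theorem rep_col {m n κ i j : ℕ} (hi : i < m) (hj : j < n) {M : Matrix (Fin n) (Fin n) ℝ}
    (hM : DimRep m n κ i (j + 1) (gmat n (i + κ) (j + 1) * M)) :
    DimRep m n κ i j (gmat n (i + κ) j * M) := by
  by_cases hj1 : j + 1 < n
  · have key : ∀ a b : Fin n,
        ((a : ℕ) = j ∧ (b : ℕ) = j + 1) ∨ ((b : ℕ) = j ∧ (a : ℕ) = j + 1) →
        ((b : ℕ) + (i + κ)) % 2 = 1 → DimRep m n κ i j (gmat n (i + κ) j * M) := by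
      intro a b hab hb
      have := rep_step hi hab hb hM
      rw [gmat_update hab hb, Matrix.updateRow_mul, Matrix.add_vecMul]
      exact this
    by_cases hp : (j + (i + κ)) % 2 = 1
    · exact key ⟨j + 1, hj1⟩ ⟨j, hj⟩ (by simp) hp
    · exact key ⟨j, hj⟩ ⟨j + 1, hj1⟩ (by simp) (by simp; omega)
  · have e : gmat n (i + κ) j = gmat n (i + κ) (j + 1) := by
      ext r c
      simp only [gmat, Matrix.of_apply, add_right_inj]
      congr 1
      rw [eq_iff_iff]
      omega
    rw [e]
    intro X h
    rw [← hM X h]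
    congr 1
    by_cases hX : ((⟨j, hj⟩ : Fin n) ∈ X ↔ (i + j + κ) % 2 = 1)
    · exact Zc_present hi hj hX (fun h => absurd h hj1)
    · exact Zc_absent hi hj hX

theorem rep_row {m n κ i : ℕ} (hi : i < m) {M : Matrix (Fin n) (Fin n) ℝ}
    (hM : DimRep m n κ (i + 1) 0 M) : DimRep m n κ i 0 (gmat n (i + κ) 0 * M) := by
  have key : ∀ d j, j + d = n → DimRep m n κ i j (gmat n (i + κ) j * M) := by
    intro d
    induction d with
    | zero =>
      intro j hj
      obtain rfl : j = n := by omega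
      have e : gmat j (i + κ) j = 1 := by
        ext r c
        have := r.2
        simp only [gmat, Matrix.of_apply]
        rw [if_neg (c := ((r : ℕ) + (i + κ)) % 2 = 1 ∧ _) (by omega), add_zero, Matrix.one_apply]
      rw [e, one_mul]
      intro X h
      rw [Zc_next_row]
      exact hM X h
    | succ d ih =>
      intro j hj
      exact rep_col hi (by omega) (ih (j + 1) (by omega))
  exact key n 0 (by omega)

theorem rep_end {m n κ : ℕ} (hm : Even m) : DimRep m n κ m 0 1 := by
  intro X h
  rw [Zc_end hm]
  split_ifs with hX
  · subst hX
    rw [Matrix.submatrix_one _ (Finset.orderEmbOfFin _ _).injective]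
    simp
  · have : ∃ b ∈ X, b ∉ X0 n κ := by
      by_contra hcon
      push Not at hcon
      exact hX (Finset.eq_of_subset_of_card_le hcon h.ge)
    obtain ⟨b, hb, hb'⟩ := this
    obtain ⟨i0, hi0⟩ : b ∈ Set.range (X.orderEmbOfFin h) := by
      rw [Finset.range_orderEmbOfFin]; exact hb
    symm
    rw [Nat.cast_zero]
    apply Matrix.det_eq_zero_of_row_eq_zero i0
    intro j
    rw [Matrix.submatrix_apply, hi0, Matrix.one_apply_ne]
    intro h0
    apply hb'
    rw [h0]
    exact Finset.orderEmbOfFin_mem _ _ _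

theorem gmat_parity (n : ℕ) {s s' : ℕ} (h : s % 2 = s' % 2) : gmat n s 0 = gmat n s' 0 := by
  ext r c
  simp only [gmat, Matrix.of_apply, add_right_inj]
  congr 1
  rw [eq_iff_iff]
  omega

theorem rep_all {n κ t : ℕ} :
    DimRep (2 * t) n κ 0 0 ((gmat n κ 0 * gmat n (κ + 1) 0) ^ t) := by
  have key : ∀ d i, i + d = t →
      DimRep (2 * t) n κ (2 * i) 0 ((gmat n κ 0 * gmat n (κ + 1) 0) ^ d) := by
    intro d
    induction d with
    | zero =>
      intro i hi
      obtain rfl : i = t := by omega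
      rw [pow_zero]
      exact rep_end (even_two_mul i)
    | succ d ih =>
      intro i hi
      have h1 := rep_row (i := 2 * i + 1) (by omega) (ih (i + 1) (by omega))
      have h2 := rep_row (i := 2 * i) (by omega) h1
      rw [pow_succ', mul_assoc, gmat_parity n (s := κ) (s' := 2 * i + κ) (by omega),
        gmat_parity n (s := κ + 1) (s' := 2 * i + 1 + κ) (by omega)]
      rw [gmat_parity n (s := κ) (s' := 2 * i + κ) (by omega),
        gmat_parity n (s := κ + 1) (s' := 2 * i + 1 + κ) (by omega)] at h2
      exact h2
  exact key t 0 (by omega)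

theorem count_minor {n κ t : ℕ} (ht : 0 < t) : (gridMatchCount (2 * t) n : ℝ) =
    (((gmat n κ 0 * gmat n (κ + 1) 0) ^ t).submatrix ((X0 n κ).orderEmbOfFin rfl)
      ((X0 n κ).orderEmbOfFin rfl)).det := by
  rw [← Zc_start (κ := κ) (by omega : 0 < 2 * t)]
  exact rep_all _ rfl


/-- the Fibonacci-type polynomials -/
def abseq {R : Type} [Ring R] (x : R) : ℕ → R × R
  | 0 => (1, 0)
  | t + 1 => ((abseq x t).1 + x * ((abseq x t).2 + x * (abseq x t).1),
      (abseq x t).2 + x * (abseq x t).1)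

theorem ring_step {R : Type} [Ring R] {P H A B : R} (hP : P * P = P) (hH : H * P = H - P * H)
    (hA : P * A = A * P) (hB : P * B = B - B * P) :
    (1 + P * H) * ((1 + (1 - P) * H) * ((A + B) * P)) =
      ((A + H * (B + H * A)) + (B + H * A)) * P := by
  have h1 : (1 - P) * H = H * P := by rw [hH]; noncomm_ring
  have h2 : P * H = H - H * P := by rw [hH]; noncomm_ring
  have hPBP : P * (B * P) = 0 := by rw [← mul_assoc, hB, sub_mul, mul_assoc, hP, sub_self]
  have hPAP : P * (A * P) = A * P := by rw [← mul_assoc, hA, mul_assoc, hP]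
  have s1 : (1 + (1 - P) * H) * ((A + B) * P) = A * P + B * P + H * (A * P) := by
    rw [h1, add_mul, one_mul, add_mul A B P, mul_assoc H P, mul_add P, hPBP, hPAP, add_zero]
  have hPHAP : P * (H * (A * P)) = 0 := by
    rw [← mul_assoc, h2, sub_mul, mul_assoc, hPAP, sub_self]
  have hPH1 : P * (H * (B * P)) = H * (B * P) := by
    rw [← mul_assoc, h2, sub_mul, mul_assoc, hPBP, mul_zero, sub_zero]
  have hPH2 : P * (H * (H * (A * P))) = H * (H * (A * P)) := by
    rw [← mul_assoc P, h2, sub_mul, mul_assoc H P, hPHAP, mul_zero, sub_zero]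
  rw [s1, add_mul, one_mul, mul_assoc P, mul_add H, mul_add H, mul_add P, mul_add P, hPHAP, hPH1, hPH2]
  noncomm_ring

theorem abseq_comm {R : Type} [Ring R] {P H : R} (hH : H * P = H - P * H) (t : ℕ) :
    P * (abseq H t).1 = (abseq H t).1 * P ∧
    P * (abseq H t).2 = (abseq H t).2 - (abseq H t).2 * P := by
  induction t with
  | zero => simp [abseq]
  | succ t ih =>
    obtain ⟨h1, h2⟩ := ih
    have hPH : P * H = H - H * P := by rw [hH]; noncomm_ring
    simp only [abseq]
    generalize (abseq H t).1 = A at *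
    generalize (abseq H t).2 = B at *
    have h3 : P * (B + H * A) = (B + H * A) - (B + H * A) * P := by
      rw [mul_add, h2, ← mul_assoc, hPH, sub_mul, mul_assoc H P, h1]
      noncomm_ring
    refine ⟨?_, h3⟩
    generalize B + H * A = C at *
    rw [mul_add, h1, ← mul_assoc, hPH, sub_mul, mul_assoc H P, h3]
    noncomm_ring

theorem ring_pow {R : Type} [Ring R] {P H : R} (hP : P * P = P) (hH : H * P = H - P * H) (t : ℕ) :
    ((1 + P * H) * (1 + (1 - P) * H)) ^ t * P = ((abseq H t).1 + (abseq H t).2) * P := by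
  induction t with
  | zero => simp [abseq]
  | succ t ih =>
    rw [pow_succ', mul_assoc, ih, mul_assoc, ring_step hP hH (abseq_comm hH t).1 (abseq_comm hH t).2]
    simp only [abseq]

theorem ring_pow' {R : Type} [Ring R] {P H : R} (hP : P * P = P) (hH : H * P = H - P * H) (t : ℕ) :
    P * ((1 + P * H) * (1 + (1 - P) * H)) ^ t * P = P * (abseq H t).1 * P := by
  rw [mul_assoc, ring_pow hP hH, add_mul, mul_add, ← mul_assoc P (abseq H t).2,
    (abseq_comm hH t).2, sub_mul, mul_assoc (abseq H t).2, hP, sub_self, add_zero, mul_assoc]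

def hmat (n : ℕ) : Matrix (Fin n) (Fin n) ℝ := Matrix.of fun r c =>
  if (r : ℕ) + 1 = c ∨ (c : ℕ) + 1 = r then 1 else 0

def pmat (n κ : ℕ) : Matrix (Fin n) (Fin n) ℝ :=
  Matrix.diagonal fun r => if ((r : ℕ) + κ) % 2 = 1 then 1 else 0

theorem pmat_sq (n κ : ℕ) : pmat n κ * pmat n κ = pmat n κ := by
  unfold pmat
  rw [Matrix.diagonal_mul_diagonal]
  simp

theorem hmat_pmat (n κ : ℕ) : hmat n * pmat n κ = hmat n - pmat n κ * hmat n := by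
  ext r c
  simp only [pmat, hmat, Matrix.mul_diagonal, Matrix.sub_apply, Matrix.diagonal_mul, Matrix.of_apply]
  split_ifs <;> first | omega | norm_num

theorem gmat_eq (n κ : ℕ) : gmat n κ 0 = 1 + pmat n κ * hmat n := by
  ext r c
  simp only [gmat, pmat, hmat, Matrix.diagonal_mul, Matrix.of_apply, Matrix.add_apply,
    Matrix.one_apply, add_right_inj]
  split_ifs <;> first | omega | norm_num

theorem gmat_eq' (n κ : ℕ) : gmat n (κ + 1) 0 = 1 + (1 - pmat n κ) * hmat n := by
  rw [gmat_eq]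
  congr 2
  ext r c
  simp only [pmat, Matrix.sub_apply, Matrix.one_apply, Matrix.diagonal_apply]
  split_ifs <;> first | omega | norm_num

theorem det_block {n k : ℕ} (M : Matrix (Fin n) (Fin n) ℝ) (p : Fin n → Prop) [DecidablePred p]
    (e : Fin k → Fin n) (he : Function.Injective e) (hr : ∀ r, p r ↔ r ∈ Set.range e) :
    (M.submatrix e e).det = (M.toSquareBlockProp p).det := by
  let E : Fin k ≃ {r // p r} := Equiv.ofBijective (fun i => ⟨e i, (hr _).2 ⟨i, rfl⟩⟩)
    ⟨fun i j h => he (by simpa using h), fun ⟨r, h⟩ => by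
      obtain ⟨i, hi⟩ := (hr r).1 h
      exact ⟨i, Subtype.ext hi⟩⟩
  rw [← Matrix.det_submatrix_equiv_self E]
  rfl

theorem det_block_congr {n : ℕ} (M : Matrix (Fin n) (Fin n) ℝ) (p q : Fin n → Prop)
    [DecidablePred p] [DecidablePred q] (h : ∀ r, p r ↔ q r) :
    (M.toSquareBlockProp p).det = (M.toSquareBlockProp q).det := by
  obtain rfl : p = q := funext fun r => propext (h r)
  congr!

theorem count_block {n κ t : ℕ} (ht : 0 < t) : (gridMatchCount (2 * t) n : ℝ) =
    ((abseq (hmat n) t).1.toSquareBlockProp fun r => ((r : ℕ) + κ) % 2 = 1).det := by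
  have hmem : ∀ r : Fin n, (((r : ℕ) + κ) % 2 = 1 ↔
      r ∈ Set.range ((X0 n κ).orderEmbOfFin rfl)) := by
    intro r
    rw [Finset.range_orderEmbOfFin]
    simp [X0]
  rw [count_minor (κ := κ) ht, ← det_block _ _ ((X0 n κ).orderEmbOfFin rfl)
    (RelEmbedding.injective _) hmem]
  congr 1
  ext i j
  have h := ring_pow' (pmat_sq n κ) (hmat_pmat n κ) t
  rw [← gmat_eq, ← gmat_eq'] at h
  have h2 := congrFun (congrFun h ((X0 n κ).orderEmbOfFin rfl i)) ((X0 n κ).orderEmbOfFin rfl j)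
  have hi := (hmem ((X0 n κ).orderEmbOfFin rfl i)).2 ⟨i, rfl⟩
  have hj := (hmem ((X0 n κ).orderEmbOfFin rfl j)).2 ⟨j, rfl⟩
  rw [pmat, Matrix.mul_diagonal, Matrix.mul_diagonal, Matrix.diagonal_mul, Matrix.diagonal_mul,
    if_pos hi, if_pos hj] at h2
  simpa using h2

theorem count_sq {n t : ℕ} (ht : 0 < t) : (gridMatchCount (2 * t) n : ℝ) ^ 2 =
    (abseq (hmat n) t).1.det := by
  rw [Matrix.twoBlockTriangular_det _ (fun r : Fin n => ((r : ℕ) + 0) % 2 = 1), sq]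
  · congr 1
    · exact count_block (κ := 0) ht
    · rw [count_block (κ := 1) ht]
      apply det_block_congr
      intro r; omega
  · intro r hr c hc
    have h := (abseq_comm (hmat_pmat n 0) t).1
    have h2 := congrFun (congrFun h r) c
    rw [pmat, Matrix.diagonal_mul, Matrix.mul_diagonal, if_pos hc, if_neg hr] at h2
    simpa using h2.symm

noncomputable def ang (n : ℕ) (l : Fin n) : ℝ := ((l : ℕ) + 1 : ℝ) * Real.pi / (n + 1)

noncomputable def smat (n : ℕ) : Matrix (Fin n) (Fin n) ℝ := Matrix.of fun r l =>
  Real.sin (((r : ℕ) + 1 : ℝ) * ang n l)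

theorem hmat_smat (n : ℕ) : hmat n * smat n =
    smat n * Matrix.diagonal fun l => 2 * Real.cos (ang n l) := by
  ext r l
  rw [Matrix.mul_diagonal, Matrix.mul_apply]
  set w : ℕ → ℝ := fun k => Real.sin ((k : ℝ) * ang n l) with hw
  have h0 : w 0 = 0 := by simp [hw]
  have hn : w (n + 1) = 0 := by
    have : ((n + 1 : ℕ) : ℝ) * ang n l = ((l : ℕ) + 1 : ℕ) * Real.pi := by
      unfold ang; push_cast; field_simp
    simp only [hw]
    rw [this, Real.sin_nat_mul_pi]
  have e1 : ∀ c : Fin n, hmat n r c * smat n c l =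
      (fun c : ℕ => (if (r : ℕ) + 1 = c then w (c + 1) else 0) +
        (if c + 1 = (r : ℕ) then w (c + 1) else 0)) (c : ℕ) := by
    intro c
    have : smat n c l = w (c + 1) := by simp [smat, hw]
    rw [this]
    simp only [hmat, Matrix.of_apply]
    split_ifs <;> first | omega | simp
  rw [Finset.sum_congr rfl fun c _ => e1 c, Fin.sum_univ_eq_sum_range (fun c : ℕ =>
    (if (r : ℕ) + 1 = c then w (c + 1) else 0) + (if c + 1 = (r : ℕ) then w (c + 1) else 0)) n,
    Finset.sum_add_distrib]
  have s1 : ∑ c ∈ Finset.range n, (if (r : ℕ) + 1 = c then w (c + 1) else 0) = w (r + 2) := by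
    rw [Finset.sum_ite_eq]
    split_ifs with h
    · rfl
    · have : (r : ℕ) + 2 = n + 1 := by have := r.2; simp at h; omega
      rw [this, hn]
  have s2 : ∑ c ∈ Finset.range n, (if c + 1 = (r : ℕ) then w (c + 1) else 0) = w r := by
    rcases hr : (r : ℕ) with _ | r'
    · simp [h0]
    · simp only [add_left_inj]
      rw [Finset.sum_ite_eq', if_pos]
      have := r.2; simp; omega
  rw [s1, s2]
  simp only [hw, smat, Matrix.of_apply]
  have a1 : ((r + 2 : ℕ) : ℝ) * ang n l = ((r : ℕ) + 1 : ℝ) * ang n l + ang n l := by push_cast; ring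
  have a2 : ((r : ℕ) : ℝ) * ang n l = ((r : ℕ) + 1 : ℝ) * ang n l - ang n l := by ring
  rw [a1, a2, Real.sin_add, Real.sin_sub]
  ring

theorem ang_mem (n : ℕ) (l : Fin n) : 0 < ang n l ∧ ang n l < Real.pi := by
  have : (l : ℝ) + 1 < n + 1 := by have := l.2; exact_mod_cast Nat.succ_lt_succ this
  unfold ang
  constructor
  · positivity
  · rw [div_lt_iff₀ (by positivity), mul_comm]
    exact mul_lt_mul_of_pos_left this Real.pi_pos

theorem ang_inj (n : ℕ) : Function.Injective (fun l : Fin n => 2 * Real.cos (ang n l)) := by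
  intro l l' h
  have h1 : Real.cos (ang n l) = Real.cos (ang n l') := by simpa using h
  have h2 := Real.injOn_cos ⟨(ang_mem n l).1.le, (ang_mem n l).2.le⟩
    ⟨(ang_mem n l').1.le, (ang_mem n l').2.le⟩ h1
  unfold ang at h2
  have hpi := Real.pi_pos
  field_simp at h2
  have : (l : ℝ) = l' := by linarith
  exact Fin.ext (by exact_mod_cast this)

theorem smat_det (n : ℕ) : (smat n).det ≠ 0 := by
  have hli : LinearIndependent ℝ (fun l => (smat n).col l) := by
    apply Module.End.eigenvectors_linearIndependent' (Matrix.toLin' (hmat n))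
      (fun l => 2 * Real.cos (ang n l)) (ang_inj n)
    intro l
    rw [Module.End.hasEigenvector_iff, Module.End.mem_eigenspace_iff]
    constructor
    · ext r
      have := congrFun (congrFun (hmat_smat n) r) l
      rw [Matrix.mul_diagonal, Matrix.mul_apply] at this
      simp only [Matrix.toLin'_apply, Matrix.mulVec, dotProduct, Pi.smul_apply, smul_eq_mul,
        Matrix.col_apply]
      rw [this, mul_comm]
    · intro h
      have hn : 0 < n := by have := l.2; omega
      have := congrFun h ⟨0, hn⟩
      simp [smat] at this
      have h2 := Real.sin_pos_of_pos_of_lt_pi (ang_mem n l).1 (ang_mem n l).2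
      exact h2.ne' this
  have := Matrix.linearIndependent_cols_iff_isUnit.1 hli
  rw [Matrix.isUnit_iff_isUnit_det] at this
  exact this.ne_zero

theorem abseq_conj {R : Type} [Ring R] {H S D : R} (h : H * S = S * D) (t : ℕ) :
    (abseq H t).1 * S = S * (abseq D t).1 ∧ (abseq H t).2 * S = S * (abseq D t).2 := by
  induction t with
  | zero => simp [abseq]
  | succ t ih =>
    simp only [abseq]
    obtain ⟨h1, h2⟩ := ih
    have h3 : ((abseq H t).2 + H * (abseq H t).1) * S = S * ((abseq D t).2 + D * (abseq D t).1) := by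
      rw [add_mul, h2, mul_assoc, h1, ← mul_assoc, h, mul_add, mul_assoc]
    refine ⟨?_, h3⟩
    rw [add_mul, h1, mul_assoc, h3, ← mul_assoc, h, mul_add S (abseq D t).1, mul_assoc S D]

theorem abseq_diagonal {n : ℕ} (d : Fin n → ℝ) (t : ℕ) :
    (abseq (Matrix.diagonal d) t).1 = Matrix.diagonal (fun l => (abseq (d l) t).1) ∧
    (abseq (Matrix.diagonal d) t).2 = Matrix.diagonal (fun l => (abseq (d l) t).2) := by
  induction t with
  | zero => simp [abseq]
  | succ t ih =>
    simp only [abseq, ih.1, ih.2, Matrix.diagonal_mul_diagonal, Matrix.diagonal_add]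
    simp

theorem count_prod {n t : ℕ} (ht : 0 < t) : (gridMatchCount (2 * t) n : ℝ) ^ 2 =
    ∏ l : Fin n, (abseq (2 * Real.cos (ang n l)) t).1 := by
  rw [count_sq ht]
  have h := congrArg Matrix.det (abseq_conj (hmat_smat n) t).1
  rw [Matrix.det_mul, Matrix.det_mul, (abseq_diagonal _ t).1, Matrix.det_diagonal, mul_comm] at h
  exact mul_left_cancel₀ (smat_det n) h

theorem abseq_cosh (a : ℝ) (t : ℕ) :
    (abseq (2 * Real.sinh a) t).1 * Real.cosh a = Real.cosh ((2 * t + 1) * a) ∧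
    (abseq (2 * Real.sinh a) t).2 * Real.cosh a = Real.sinh ((2 * t) * a) := by
  induction t with
  | zero => simp [abseq]
  | succ t ih =>
    obtain ⟨h1, h2⟩ := ih
    simp only [abseq]
    have e1 : (2 * (t : ℝ)) * a = (2 * t + 1) * a - a := by ring
    have e2 : (2 * ((t + 1 : ℕ) : ℝ)) * a = (2 * t + 1) * a + a := by push_cast; ring
    have e3 : (2 * ((t + 1 : ℕ) : ℝ) + 1) * a = (2 * ((t + 1 : ℕ) : ℝ)) * a + a := by ring
    have e4 : (2 * (t : ℝ) + 1) * a = (2 * ((t + 1 : ℕ) : ℝ)) * a - a := by push_cast; ring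
    have h3 : ((abseq (2 * Real.sinh a) t).2 + 2 * Real.sinh a * (abseq (2 * Real.sinh a) t).1) *
        Real.cosh a = Real.sinh ((2 * ((t + 1 : ℕ) : ℝ)) * a) := by
      rw [add_mul, h2, mul_assoc (2 * Real.sinh a), h1, e1, e2, Real.sinh_add, Real.sinh_sub]; ring
    refine ⟨?_, h3⟩
    rw [add_mul, h1, mul_assoc (2 * Real.sinh a), h3, e3, e4, Real.cosh_add, Real.cosh_sub]; ring


lemma arsinh_integral (c : ℝ) :
    ∫ t in (0:ℝ)..1, c / √(1 + (t * c) ^ 2) = Real.arsinh c := by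
  have h : ∀ t ∈ Set.uIcc (0:ℝ) 1,
      HasDerivAt (fun t : ℝ => Real.arsinh (t * c)) (c / √(1 + (t * c) ^ 2)) t := by
    intro t _
    have h1 : HasDerivAt (fun t : ℝ => t * c) c t := by
      simpa using (hasDerivAt_id t).mul_const c
    have := h1.arsinh
    convert this using 1
    simp [div_eq_inv_mul]
  rw [intervalIntegral.integral_eq_sub_of_hasDerivAt h]
  · simp
  · apply Continuous.intervalIntegrable
    apply Continuous.div continuous_const (by fun_prop)
    intro t
    positivity

lemma inner_integral (t : ℝ) (ht : 0 < t) :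
    ∫ θ in (0:ℝ)..(Real.pi / 2), Real.cos θ / √(1 + (t * Real.cos θ) ^ 2)
      = Real.arctan t / t := by
  have hs : 0 < √(1 + t ^ 2) := by positivity
  have hs2 : √(1 + t ^ 2) ^ 2 = 1 + t ^ 2 := Real.sq_sqrt (by positivity)
  have h : ∀ θ ∈ Set.uIcc (0:ℝ) (Real.pi / 2),
      HasDerivAt (fun θ : ℝ => Real.arcsin (t * Real.sin θ / √(1 + t ^ 2)) / t)
        (Real.cos θ / √(1 + (t * Real.cos θ) ^ 2)) θ := by
    intro θ _
    have h1 : HasDerivAt (fun θ : ℝ => t * Real.sin θ / √(1 + t ^ 2))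
        (t * Real.cos θ / √(1 + t ^ 2)) θ :=
      ((Real.hasDerivAt_sin θ).const_mul t).div_const _
    have hkey : 1 - (t * Real.sin θ / √(1 + t ^ 2)) ^ 2
        = (1 + (t * Real.cos θ) ^ 2) / (1 + t ^ 2) := by
      rw [div_pow, hs2, mul_pow, Real.sin_sq]
      field_simp
      ring
    have hlt : (t * Real.sin θ / √(1 + t ^ 2)) ^ 2 < 1 := by
      have : 0 < (1 + (t * Real.cos θ) ^ 2) / (1 + t ^ 2) := by positivity
      linarith
    have hab := abs_lt.1 ((sq_lt_one_iff_abs_lt_one _).1 hlt)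
    have h2 := (Real.hasDerivAt_arcsin (ne_of_gt hab.1) (ne_of_lt hab.2)).comp θ h1
    have h3 := h2.div_const t
    refine h3.congr_deriv ?_
    rw [hkey, Real.sqrt_div (by positivity)]
    have : 0 < √(1 + (t * Real.cos θ) ^ 2) := by positivity
    field_simp
  rw [intervalIntegral.integral_eq_sub_of_hasDerivAt h]
  · simp [Real.arctan_eq_arcsin]
  · apply Continuous.intervalIntegrable
    apply Continuous.div (by fun_prop) (by fun_prop)
    intro t
    positivity

lemma summable_odd : Summable (fun k : ℕ => 1 / (2 * (k:ℝ) + 1) ^ 2) := by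
  have h := (summable_nat_add_iff 1).2 (Real.summable_one_div_nat_pow.2 (by norm_num : 1 < 2))
  refine Summable.of_nonneg_of_le (fun k => by positivity) (fun k => ?_) h
  push_cast
  apply one_div_le_one_div_of_le (by positivity)
  apply pow_le_pow_left₀ (by positivity)
  have : (0:ℝ) ≤ k := by positivity
  linarith

lemma arctan_integral :
    ∫ t in (0:ℝ)..1, Real.arctan t / t = ∑' k : ℕ, (-1 : ℝ) ^ k / (2 * k + 1) ^ 2 := by
  have hpowint : ∀ k : ℕ, ∫ t in (0:ℝ)..1, t ^ (2 * k) / (2 * (k:ℝ) + 1)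
      = 1 / (2 * (k:ℝ) + 1) ^ 2 := by
    intro k
    rw [intervalIntegral.integral_div, integral_pow]
    push_cast
    simp
    field_simp
  have H := MeasureTheory.hasSum_integral_of_summable_integral_norm
    (μ := MeasureTheory.volume.restrict (Set.Ioc (0:ℝ) 1))
    (F := fun (k : ℕ) (t : ℝ) => (-1 : ℝ) ^ k * (t ^ (2 * k) / (2 * (k:ℝ) + 1))) ?_ ?_
  · have hterm : ∀ k : ℕ, ∫ t in Set.Ioc (0:ℝ) 1,
        (-1 : ℝ) ^ k * (t ^ (2 * k) / (2 * (k:ℝ) + 1)) = (-1 : ℝ) ^ k / (2 * k + 1) ^ 2 := by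
      intro k
      rw [← intervalIntegral.integral_of_le zero_le_one, intervalIntegral.integral_const_mul,
        hpowint k]
      ring
    simp only [hterm] at H
    rw [H.tsum_eq, intervalIntegral.integral_of_le zero_le_one]
    apply MeasureTheory.integral_congr_ae
    have h1 : ∀ᵐ t : ℝ ∂(MeasureTheory.volume.restrict (Set.Ioc (0:ℝ) 1)), t ≠ 1 :=
      MeasureTheory.ae_restrict_of_ae (MeasureTheory.Measure.ae_ne _ 1)
    filter_upwards [h1, MeasureTheory.ae_restrict_mem measurableSet_Ioc] with t ht1 ht
    have hlt : t < 1 := lt_of_le_of_ne ht.2 ht1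
    have hs := Real.hasSum_arctan (x := t) (by rw [Real.norm_of_nonneg ht.1.le]; exact hlt)
    have hs' := hs.div_const t
    rw [← hs'.tsum_eq]
    congr 1
    ext k
    have := ht.1
    push_cast
    field_simp
    ring
  · intro k
    have : Continuous (fun t : ℝ => (-1 : ℝ) ^ k * (t ^ (2 * k) / (2 * (k:ℝ) + 1))) := by
      fun_prop
    exact (this.intervalIntegrable 0 1).1
  · convert summable_odd using 2 with k
    rw [← hpowint k, intervalIntegral.integral_of_le zero_le_one]
    congr 1
    ext t
    rw [norm_mul, norm_pow, norm_neg, norm_one, one_pow, one_mul, Real.norm_of_nonneg]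
    have := (even_two_mul k).pow_nonneg t
    positivity

lemma arsinh_cos_half : ∫ θ in (0:ℝ)..(Real.pi / 2), Real.arsinh (Real.cos θ)
    = ∑' k : ℕ, (-1 : ℝ) ^ k / (2 * k + 1) ^ 2 := by
  rw [← arctan_integral]
  have h1 : ∀ θ : ℝ, Real.arsinh (Real.cos θ)
      = ∫ t in (0:ℝ)..1, Real.cos θ / √(1 + (t * Real.cos θ) ^ 2) :=
    fun θ => (arsinh_integral _).symm
  simp only [h1]
  rw [MeasureTheory.intervalIntegral_intervalIntegral_swap]
  · apply intervalIntegral.integral_congr_ae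
    refine Filter.Eventually.of_forall fun t ht => ?_
    rw [Set.uIoc_of_le zero_le_one] at ht
    exact inner_integral t ht.1
  · have hc : Continuous (Function.uncurry
        fun θ t : ℝ => Real.cos θ / √(1 + (t * Real.cos θ) ^ 2)) := by
      apply Continuous.div (by fun_prop) (by fun_prop)
      intro t
      positivity
    have hk : IsCompact (Set.uIcc (0:ℝ) (Real.pi / 2) ×ˢ Set.uIcc (0:ℝ) 1) :=
      isCompact_uIcc.prod isCompact_uIcc
    exact (hc.continuousOn.integrableOn_compact hk).mono_set
      (Set.prod_mono Set.uIoc_subset_uIcc Set.uIoc_subset_uIcc)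

noncomputable def phi (θ : ℝ) : ℝ := |Real.arsinh (Real.cos θ)|

lemma phi_lip : LipschitzWith 1 phi := by
  have h1 : LipschitzWith 1 Real.arsinh := by
    apply lipschitzWith_of_nnnorm_deriv_le Real.differentiable_arsinh
    intro x
    rw [(Real.hasDerivAt_arsinh x).deriv, ← NNReal.coe_le_coe, coe_nnnorm,
      Real.norm_of_nonneg (by positivity)]
    apply inv_le_one_of_one_le₀
    rw [Real.one_le_sqrt]
    nlinarith [sq_nonneg x]
  have h2 := h1.comp Real.lipschitzWith_cos
  have h3 : LipschitzWith 1 (fun x : ℝ => |x|) := by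
    exact lipschitzWith_one_norm (E := ℝ)
  have := h3.comp h2
  rw [one_mul, one_mul] at this
  exact this

lemma phi_cont : Continuous phi := phi_lip.continuous

lemma phi_bound (x y : ℝ) : |phi x - phi y| ≤ |x - y| := by
  have := phi_lip.dist_le_mul x y
  simpa [Real.dist_eq] using this

lemma phi_nonneg (x : ℝ) : 0 ≤ phi x := abs_nonneg _

lemma phi_le_two (x : ℝ) : phi x ≤ 2 := by
  unfold phi
  rw [abs_le]
  have h1 : Real.sinh 2 ≥ 1 := by
    have := Real.self_le_sinh_iff.2 (by norm_num : (0:ℝ) ≤ 2)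
    linarith
  constructor
  · rw [← Real.sinh_le_sinh, Real.sinh_arsinh, Real.sinh_neg]
    linarith [Real.neg_one_le_cos x]
  · rw [← Real.sinh_le_sinh, Real.sinh_arsinh]
    linarith [Real.cos_le_one x]

lemma phi_integral : ∫ θ in (0:ℝ)..Real.pi, phi θ
    = 2 * ∑' k : ℕ, (-1 : ℝ) ^ k / (2 * k + 1) ^ 2 := by
  have hpi := Real.pi_pos
  rw [← intervalIntegral.integral_add_adjacent_intervals (b := Real.pi / 2)
    (phi_cont.intervalIntegrable _ _) (phi_cont.intervalIntegrable _ _)]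
  have h1 : ∫ θ in (0:ℝ)..(Real.pi / 2), phi θ
      = ∫ θ in (0:ℝ)..(Real.pi / 2), Real.arsinh (Real.cos θ) := by
    apply intervalIntegral.integral_congr
    intro θ hθ
    rw [Set.uIcc_of_le (by positivity)] at hθ
    apply abs_of_nonneg
    rw [Real.arsinh_nonneg_iff]
    exact Real.cos_nonneg_of_mem_Icc ⟨by linarith [hθ.1], hθ.2⟩
  have h2 : ∫ θ in (Real.pi / 2)..Real.pi, phi θ = ∫ θ in (0:ℝ)..(Real.pi / 2), phi θ := by
    have h := intervalIntegral.integral_comp_sub_left (a := 0) (b := Real.pi / 2) phi Real.pi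
    rw [sub_zero, show Real.pi - Real.pi / 2 = Real.pi / 2 by ring] at h
    rw [← h]
    congr 1
    ext θ
    simp [phi, Real.cos_pi_sub, Real.arsinh_neg]
  rw [h2, h1, arsinh_cos_half]
  ring

/-- the average of `phi` over the angles -/
noncomputable def angSum (n : ℕ) : ℝ := ∑ l : Fin n, phi (ang n l)

lemma riemann (n : ℕ) :
    |Real.pi / (n + 1) * angSum n - ∫ θ in (0:ℝ)..Real.pi, phi θ|
      ≤ 20 / (n + 1) := by
  set h : ℝ := Real.pi / (n + 1) with hh
  have hn : (0:ℝ) < n + 1 := by positivity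
  have hpos : 0 < h := by positivity
  have hsum : ∑ k ∈ Finset.range (n + 1),
      ∫ θ in ((k : ℕ) * h)..((k + 1 : ℕ) * h), phi θ = ∫ θ in (0:ℝ)..Real.pi, phi θ := by
    rw [intervalIntegral.sum_integral_adjacent_intervals (a := fun k : ℕ => (k:ℝ) * h)
      (fun k _ => phi_cont.intervalIntegrable _ _)]
    congr 1
    · simp
    · push_cast
      rw [hh]
      field_simp
  have hpiece : ∀ k : ℕ, |h * phi ((k + 1 : ℕ) * h)
      - ∫ θ in ((k : ℕ) * h)..((k + 1 : ℕ) * h), phi θ| ≤ h * h := by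
    intro k
    have e : h * phi ((k + 1 : ℕ) * h)
        = ∫ θ in ((k : ℕ) * h)..((k + 1 : ℕ) * h), phi ((k + 1 : ℕ) * h) := by
      rw [intervalIntegral.integral_const, smul_eq_mul]
      push_cast
      ring
    rw [e, ← intervalIntegral.integral_sub (continuous_const.intervalIntegrable _ _)
      (phi_cont.intervalIntegrable _ _), ← Real.norm_eq_abs]
    refine (intervalIntegral.norm_integral_le_of_norm_le_const (C := h) ?_).trans ?_
    · intro x hx
      rw [Set.uIoc_of_le (by push_cast; nlinarith)] at hx
      refine (phi_bound _ _).trans ?_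
      have h1 := hx.1
      have h2 := hx.2
      rw [abs_of_nonneg (by linarith)]
      push_cast
      linarith
    · push_cast
      rw [show ((k:ℝ) + 1) * h - k * h = h by ring, abs_of_pos hpos]
  have hang : angSum n + phi Real.pi = ∑ k ∈ Finset.range (n + 1), phi ((k + 1 : ℕ) * h) := by
    rw [Finset.sum_range_succ, Finset.sum_range]
    congr 1
    · unfold angSum
      apply Finset.sum_congr rfl
      intro l _
      congr 1
      unfold ang
      rw [hh]
      push_cast
      ring
    · congr 1
      rw [hh]
      push_cast
      field_simp
  have hmain : |h * (angSum n + phi Real.pi) - ∫ θ in (0:ℝ)..Real.pi, phi θ|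
      ≤ (n + 1) * (h * h) := by
    rw [hang, ← hsum, Finset.mul_sum, ← Finset.sum_sub_distrib]
    refine (Finset.abs_sum_le_sum_abs _ _).trans ?_
    refine (Finset.sum_le_sum (fun k _ => hpiece k)).trans ?_
    simp
  have hhh : (n + 1) * (h * h) ≤ 12 / (n + 1) := by
    rw [hh, le_div_iff₀ hn]
    field_simp
    nlinarith [Real.pi_lt_d2, Real.pi_pos]
  have h4 : h ≤ 4 / (n + 1) := by
    rw [hh]
    gcongr
    exact Real.pi_le_four
  have hp := phi_le_two Real.pi
  have hp0 := phi_nonneg Real.pi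
  have hb : |h * phi Real.pi| ≤ 8 / (n + 1) := by
    rw [abs_of_nonneg (by positivity)]
    calc h * phi Real.pi ≤ 4 / (n + 1) * 2 := by gcongr
      _ = 8 / (n + 1) := by ring
  have : (20:ℝ) / (n + 1) = 12 / (n + 1) + 8 / (n + 1) := by ring
  rw [abs_le] at *
  constructor <;> linarith [hmain.1, hmain.2, hb.1, hb.2]

lemma angSum_nonneg (n : ℕ) : 0 ≤ angSum n := Finset.sum_nonneg fun _ _ => phi_nonneg _

lemma angSum_le (n : ℕ) : angSum n ≤ 2 * n := by
  unfold angSum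
  refine (Finset.sum_le_sum (fun l _ => phi_le_two _)).trans ?_
  simp [mul_comm]

lemma angSum_tendsto : Tendsto (fun n : ℕ => angSum n / n) atTop
    (nhds (2 * (∑' k : ℕ, (-1 : ℝ) ^ k / (2 * k + 1) ^ 2) / Real.pi)) := by
  rw [← phi_integral]
  set I := ∫ θ in (0:ℝ)..Real.pi, phi θ
  have h1 : Tendsto (fun n : ℕ => Real.pi / (n + 1) * angSum n) atTop (nhds I) := by
    rw [tendsto_iff_dist_tendsto_zero]
    refine squeeze_zero (fun _ => dist_nonneg) (fun n => ?_)
      (g := fun n : ℕ => 20 * (1 / ((n : ℝ) + 1))) ?_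
    · rw [Real.dist_eq]
      refine (riemann n).trans (le_of_eq (by ring))
    · simpa using tendsto_one_div_add_atTop_nhds_zero_nat.const_mul (20:ℝ)
  have h2 : Tendsto (fun n : ℕ => 1 + 1 / (n : ℝ)) atTop (nhds 1) := by
    simpa using tendsto_one_div_atTop_nhds_zero_nat.const_add (1:ℝ)
  have h3 := (h1.mul h2).div_const Real.pi
  rw [mul_one] at h3
  refine h3.congr' ?_
  filter_upwards [eventually_gt_atTop 0] with n hn
  have : (0:ℝ) < n := by exact_mod_cast hn
  have := Real.pi_pos
  field_simp

lemma abseq_bounds (c : ℝ) (hc : |c| ≤ 1) (t : ℕ) :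
    0 < (abseq (2 * c) t).1 ∧
    |Real.log (abseq (2 * c) t).1 - (2 * t + 1) * abs (Real.arsinh c)| ≤ 2 := by
  set a := Real.arsinh c with ha
  have h := (abseq_cosh a t).1
  rw [ha, Real.sinh_arsinh, ← ha] at h
  have hca : 0 < Real.cosh a := Real.cosh_pos a
  have hct : 0 < Real.cosh ((2 * t + 1) * a) := Real.cosh_pos _
  have hα : (abseq (2 * c) t).1 = Real.cosh ((2 * t + 1) * a) / Real.cosh a := by
    field_simp
    exact h
  have hca2 : Real.cosh a ≤ 2 := by
    rw [ha, Real.cosh_arsinh, Real.sqrt_le_left (by norm_num)]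
    have := (sq_le_one_iff_abs_le_one c).2 hc
    linarith
  have hca1 : 1 ≤ Real.cosh a := Real.one_le_cosh a
  have hl2 : Real.log 2 ≤ 1 := by linarith [Real.log_two_lt_d9]
  have hlca : Real.log (Real.cosh a) ≤ 1 := (Real.log_le_log hca hca2).trans hl2
  have hlca0 : 0 ≤ Real.log (Real.cosh a) := Real.log_nonneg hca1
  have hy : ∀ y : ℝ, |y| - 1 ≤ Real.log (Real.cosh y) ∧ Real.log (Real.cosh y) ≤ |y| := by
    intro y
    have he := Real.exp_pos |y|
    have he' := Real.exp_pos (-|y|)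
    have hee : Real.exp (-|y|) ≤ Real.exp |y| :=
      Real.exp_le_exp.2 (by linarith [abs_nonneg y])
    rw [← Real.cosh_abs, Real.cosh_eq]
    constructor
    · have : Real.log (Real.exp |y| / 2) ≤ Real.log ((Real.exp |y| + Real.exp (-|y|)) / 2) :=
        Real.log_le_log (by positivity) (by linarith)
      rw [Real.log_div he.ne' (by norm_num), Real.log_exp] at this
      linarith
    · rw [Real.log_le_iff_le_exp (by positivity)]
      linarith
  refine ⟨by rw [hα]; positivity, ?_⟩
  rw [hα, Real.log_div hct.ne' hca.ne']
  obtain ⟨h1, h2⟩ := hy ((2 * t + 1) * a)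
  rw [abs_mul, abs_of_nonneg (by positivity : (0:ℝ) ≤ 2 * t + 1)] at h1 h2
  rw [abs_le]
  constructor <;> linarith

lemma count_bound (t n : ℕ) (ht : 0 < t) :
    |2 * Real.log (gridMatchCount (2 * t) n) - (2 * t + 1) * angSum n| ≤ 2 * n := by
  have hb := fun l : Fin n => abseq_bounds (Real.cos (ang n l)) (Real.abs_cos_le_one _) t
  have h := congrArg Real.log (count_prod (n := n) ht)
  rw [Real.log_pow, Real.log_prod (fun l _ => (hb l).1.ne')] at h
  push_cast at h
  rw [h]
  unfold angSum
  rw [Finset.mul_sum, ← Finset.sum_sub_distrib]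
  refine (Finset.abs_sum_le_sum_abs _ _).trans ?_
  refine (Finset.sum_le_sum (fun l _ => (hb l).2)).trans ?_
  simp [mul_comm]

lemma count_bound' (m n : ℕ) (hm : 0 < m) (hn : 0 < n) (he : Even m) :
    |Real.log (gridMatchCount m n) / (m * n : ℝ) - angSum n / n / 2| ≤ 2 / m := by
  obtain ⟨t, ht⟩ := he.two_dvd
  subst ht
  have hb := count_bound t n (by omega)
  have hn' : (0:ℝ) < n := by exact_mod_cast hn
  have ht' : (0:ℝ) < t := by exact_mod_cast (by omega : 0 < t)
  have h1 := angSum_nonneg n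
  have h2 := angSum_le n
  push_cast
  have e : Real.log (gridMatchCount (2 * t) n) / (2 * t * n : ℝ) - angSum n / n / 2
      = (2 * Real.log (gridMatchCount (2 * t) n) - (2 * t + 1) * angSum n + angSum n)
        / (4 * t * n) := by
    field_simp
    ring
  rw [e, abs_div, abs_of_pos (by positivity : (0:ℝ) < 4 * t * n),
    div_le_div_iff₀ (by positivity) (by positivity)]
  have h3 : |2 * Real.log (gridMatchCount (2 * t) n) - (2 * t + 1) * angSum n + angSum n|
      ≤ 4 * n := by
    rw [abs_le] at *
    constructor <;> linarith [hb.1, hb.2]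
  nlinarith

lemma count_symm (m n : ℕ) : gridMatchCount m n = gridMatchCount n m := by
  unfold gridMatchCount
  refine Nat.card_congr
    { toFun := fun f => ⟨fun x => (f.1 x.swap).swap, ?_, ?_⟩
      invFun := fun f => ⟨fun x => (f.1 x.swap).swap, ?_, ?_⟩
      left_inv := ?_
      right_inv := ?_ }
  · intro x
    simp [f.2.1 x.swap]
  · intro x
    have := f.2.2 x.swap
    simpa [add_comm] using this
  · intro x
    simp [f.2.1 x.swap]
  · intro x
    have := f.2.2 x.swap
    simpa [add_comm] using this
  · intro f
    simp
  · intro f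
    simp

/-- (Temperley–Fisher, Kasteleyn) `(mn)⁻¹ log f(m,n) → G/π` as `m, n → ∞` through
values with `mn` even, where `G = ∑_{k≥0} (-1)^k/(2k+1)²` is Catalan's constant. -/
theorem dimer_entropy_two_dim :
    Tendsto (fun p : ℕ × ℕ => Real.log (gridMatchCount p.1 p.2) / (p.1 * p.2 : ℝ))
      ((atTop ×ˢ atTop) ⊓ Filter.principal {p : ℕ × ℕ | Even (p.1 * p.2)})
      (nhds ((∑' k : ℕ, (-1 : ℝ) ^ k / (2 * k + 1) ^ 2) / Real.pi)) := by
  set L := (∑' k : ℕ, (-1 : ℝ) ^ k / (2 * k + 1) ^ 2) / Real.pi with hL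
  have hE : Tendsto (fun n : ℕ => angSum n / n / 2) atTop (nhds L) := by
    have h := angSum_tendsto.div_const 2
    rw [show 2 * (∑' k : ℕ, (-1 : ℝ) ^ k / (2 * k + 1) ^ 2) / Real.pi / 2 = L by
      rw [hL]; ring] at h
    exact h
  have h2 : Tendsto (fun n : ℕ => 2 / (n : ℝ)) atTop (nhds 0) :=
    tendsto_const_div_atTop_nhds_zero_nat 2
  rw [Metric.tendsto_nhds]
  intro ε hε
  have hA := (Metric.tendsto_nhds.1 hE (ε / 2) (by positivity)).and
    ((h2.eventually (gt_mem_nhds (half_pos hε))).and (eventually_gt_atTop 0))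
  rw [Filter.eventually_inf_principal]
  filter_upwards [hA.prod_mk hA] with p hp he
  obtain ⟨⟨a1, a2, a3⟩, b1, b2, b3⟩ := hp
  rw [Real.dist_eq] at *
  have key : ∀ x y _z : ℝ, |x - y| < ε / 2 → |y - L| < ε / 2 → |x - L| < ε := by
    intro x y _ h1 h2
    rw [abs_lt] at *
    constructor <;> linarith [h1.1, h1.2, h2.1, h2.2]
  rcases Nat.even_mul.1 he with h | h
  · exact key _ _ 0 ((count_bound' p.1 p.2 a3 b3 h).trans_lt a2) b1
  · have hb := count_bound' p.2 p.1 b3 a3 h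
    rw [← count_symm, mul_comm (p.2 : ℝ)] at hb
    exact key _ _ 0 (hb.trans_lt b2) a1
end

section
/- (Hammersley, the Ulam problem) For each n let π be a uniformly random permutation of {1, …, n}, and let ℓ_n(π) be the length of the longest increasing subsequence of π, i.e. the largest k for which there exist indices i₁ < i₂ < ⋯ < i_k with π(i₁) < π(i₂) < ⋯ < π(i_k). Then there exists a constant c > 0 such that ℓ_n / √n → c in probability as n → ∞. -/
open Filter
open scoped Classical

/-- The length of the longest increasing subsequence of a permutation `π` of
`{0, …, n-1}`: the largest `k` for which there are indices `i₁ < ⋯ < i_k` with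
`π i₁ < ⋯ < π i_k`. -/
noncomputable def lisLength {n : ℕ} (π : Equiv.Perm (Fin n)) : ℕ :=
  Finset.sup
    (Finset.univ.filter fun s : Finset (Fin n) =>
      ∀ i ∈ s, ∀ j ∈ s, i < j → π i < π j)
    Finset.card

instance (n : ℕ) : MeasurableSpace (Equiv.Perm (Fin n)) := ⊤

/-- The uniform probability measure on the symmetric group of `{0, …, n-1}`. -/
noncomputable def uniformPerm (n : ℕ) : MeasureTheory.Measure (Equiv.Perm (Fin n)) :=
  (PMF.uniformOfFintype (Equiv.Perm (Fin n))).toMeasure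


namespace Ulam

/-- longest increasing subsequence within positions `S` -/
noncomputable def lisOn {n : ℕ} (π : Equiv.Perm (Fin n)) (S : Finset (Fin n)) : ℕ :=
  Finset.sup (S.powerset.filter fun s => ∀ i ∈ s, ∀ j ∈ s, i < j → π i < π j) Finset.card

theorem lisLength_eq {n : ℕ} (π : Equiv.Perm (Fin n)) : lisLength π = lisOn π Finset.univ := by
  unfold lisLength lisOn
  simp

theorem le_lisOn {n : ℕ} (π : Equiv.Perm (Fin n)) (S s : Finset (Fin n)) (hs : s ⊆ S)
    (h : ∀ i ∈ s, ∀ j ∈ s, i < j → π i < π j) : s.card ≤ lisOn π S := by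
  unfold lisOn
  exact Finset.le_sup (f := Finset.card) (by simp [hs]; exact h)

theorem exists_lisOn {n : ℕ} (π : Equiv.Perm (Fin n)) (S : Finset (Fin n)) :
    ∃ s ⊆ S, (∀ i ∈ s, ∀ j ∈ s, i < j → π i < π j) ∧ s.card = lisOn π S := by
  unfold lisOn
  obtain ⟨s, hs, h⟩ := Finset.exists_mem_eq_sup
    (S.powerset.filter fun s => ∀ i ∈ s, ∀ j ∈ s, i < j → π i < π j) ⟨∅, by simp⟩ Finset.card
  simp only [Finset.mem_filter, Finset.mem_powerset] at hs
  exact ⟨s, hs.1, hs.2, h.symm⟩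

theorem lisOn_le_card {n : ℕ} (π : Equiv.Perm (Fin n)) (S : Finset (Fin n)) :
    lisOn π S ≤ S.card := by
  obtain ⟨s, hs, -, h⟩ := exists_lisOn π S
  rw [← h]; exact Finset.card_le_card hs

theorem lisOn_le_lisLength {n : ℕ} (π : Equiv.Perm (Fin n)) (S : Finset (Fin n)) :
    lisOn π S ≤ lisLength π := by
  obtain ⟨s, hs, h', h⟩ := exists_lisOn π S
  rw [← h, lisLength_eq]; exact le_lisOn _ _ _ (Finset.subset_univ _) h'

theorem lisLength_le {n : ℕ} (π : Equiv.Perm (Fin n)) : lisLength π ≤ n := by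
  rw [lisLength_eq]; simpa using lisOn_le_card π Finset.univ

theorem lisOn_congr {n : ℕ} (π π' : Equiv.Perm (Fin n)) (S : Finset (Fin n))
    (h : ∀ i ∈ S, π i = π' i) : lisOn π S = lisOn π' S := by
  unfold lisOn
  congr 1
  apply Finset.filter_congr
  intro s hs
  rw [Finset.mem_powerset] at hs
  constructor
  · intro H i hi j hj hij
    rw [← h i (hs hi), ← h j (hs hj)]; exact H i hi j hj hij
  · intro H i hi j hj hij
    rw [h i (hs hi), h j (hs hj)]; exact H i hi j hj hij

/-- pattern transfer -/
theorem lisOn_eq_of_pattern {n m : ℕ} (π : Equiv.Perm (Fin n)) (S : Finset (Fin n))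
    (σ : Equiv.Perm (Fin m)) (e : Fin m ≃o S)
    (h : ∀ i j, σ i < σ j ↔ π (e i) < π (e j)) : lisOn π S = lisLength σ := by
  obtain ⟨E, hE⟩ : ∃ E : Fin m ↪ Fin n, ∀ i, E i = (e i : Fin n) :=
    ⟨e.toEquiv.toEmbedding.trans (Function.Embedding.subtype _), fun i => rfl⟩
  apply le_antisymm
  · obtain ⟨s, hs, h', hc⟩ := exists_lisOn π S
    rw [← hc, lisLength_eq]
    have : s = (Finset.univ.filter (fun i => (e i : Fin n) ∈ s)).map E := by
      ext x
      simp only [Finset.mem_map, Finset.mem_filter, Finset.mem_univ, true_and,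
        hE]
      constructor
      · intro hx
        exact ⟨e.symm ⟨x, hs hx⟩, by simpa using hx, by simp⟩
      · rintro ⟨a, ha, rfl⟩; exact ha
    rw [this, Finset.card_map]
    apply le_lisOn _ _ _ (Finset.subset_univ _)
    intro i hi j hj hij
    simp only [Finset.mem_filter, Finset.mem_univ, true_and] at hi hj
    rw [h]
    exact h' _ hi _ hj (by simpa using hij)
  · rw [lisLength_eq]
    obtain ⟨s, hs, h', hc⟩ := exists_lisOn σ Finset.univ
    rw [← hc, ← Finset.card_map E]
    apply le_lisOn
    · intro x hx
      simp only [Finset.mem_map, hE] at hx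
      obtain ⟨a, -, rfl⟩ := hx
      exact (e a).2
    · intro i hi j hj hij
      simp only [Finset.mem_map, hE] at hi hj
      obtain ⟨a, ha, rfl⟩ := hi
      obtain ⟨b, hb, rfl⟩ := hj
      rw [← h]
      exact h' _ ha _ hb (by simpa using hij)

theorem sum_pattern {n : ℕ} (π : Equiv.Perm (Fin n)) (S : Finset (Fin n)) (φ : ℕ → ℝ) :
    ∑ τ : Equiv.Perm S, φ (lisOn (π * Equiv.Perm.ofSubtype τ) S) =
      ∑ σ : Equiv.Perm (Fin S.card), φ (lisLength σ) := by
  let e : Fin S.card ≃o S := S.orderIsoOfFin rfl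
  let T := S.map π.toEmbedding
  let g : Fin S.card ≃o T := T.orderIsoOfFin (by simp [T])
  let p : S ≃ T := π.subtypeEquiv (by intro a; simp [T])
  let Φ : Equiv.Perm S ≃ Equiv.Perm (Fin S.card) :=
    { toFun := fun τ => (e.toEquiv.trans τ).trans (p.trans g.symm.toEquiv)
      invFun := fun σ => (e.symm.toEquiv.trans σ).trans (g.toEquiv.trans p.symm)
      left_inv := by intro τ; ext x; simp
      right_inv := by intro τ; ext x; simp }
  refine Fintype.sum_equiv Φ _ _ ?_
  intro τ
  congr 1
  apply lisOn_eq_of_pattern _ S _ e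
  intro i j
  simp [Φ, p, Equiv.Perm.ofSubtype_apply_coe]

/-- average over permutations -/
noncomputable def Ex (n : ℕ) (f : Equiv.Perm (Fin n) → ℝ) : ℝ :=
  (∑ π, f π) / (n.factorial : ℝ)

theorem Ex_add {n : ℕ} (f g : Equiv.Perm (Fin n) → ℝ) :
    Ex n (fun π => f π + g π) = Ex n f + Ex n g := by
  unfold Ex; rw [Finset.sum_add_distrib, add_div]

theorem Ex_const_mul {n : ℕ} (c : ℝ) (g : Equiv.Perm (Fin n) → ℝ) :
    Ex n (fun π => c * g π) = c * Ex n g := by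
  unfold Ex; rw [← Finset.mul_sum, mul_div_assoc]

theorem Ex_const {n : ℕ} (c : ℝ) : Ex n (fun _ => c) = c := by
  unfold Ex
  have : (n.factorial : ℝ) ≠ 0 := by positivity
  simp [Fintype.card_perm]
  field_simp

theorem Ex_mono {n : ℕ} {f g : Equiv.Perm (Fin n) → ℝ} (h : ∀ π, f π ≤ g π) :
    Ex n f ≤ Ex n g := by
  unfold Ex
  gcongr with π
  exact h π

theorem Ex_sum {n : ℕ} {ι : Type*} (s : Finset ι) (f : ι → Equiv.Perm (Fin n) → ℝ) :
    Ex n (fun π => ∑ i ∈ s, f i π) = ∑ i ∈ s, Ex n (f i) := by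
  unfold Ex; rw [Finset.sum_comm, Finset.sum_div]

theorem Ex_mul_right {n : ℕ} (f : Equiv.Perm (Fin n) → ℝ) (τ : Equiv.Perm (Fin n)) :
    Ex n (fun π => f (π * τ)) = Ex n f := by
  unfold Ex
  congr 1
  exact Fintype.sum_equiv (Equiv.mulRight τ) _ _ (fun π => rfl)

theorem sq_Ex_le {n : ℕ} (f : Equiv.Perm (Fin n) → ℝ) : (Ex n f) ^ 2 ≤ Ex n (fun π => f π ^ 2) := by
  unfold Ex
  have h := sq_sum_le_card_mul_sum_sq (s := (Finset.univ : Finset (Equiv.Perm (Fin n)))) (f := f)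
  rw [Finset.card_univ, Fintype.card_perm, Fintype.card_fin] at h
  have : (0:ℝ) < (n.factorial : ℝ) := by positivity
  rw [div_pow, div_le_div_iff₀ (by positivity) this]
  nlinarith

/-- expected length -/
noncomputable def A (m : ℕ) : ℝ := Ex m (fun σ => (lisLength σ : ℝ))

theorem Ex_pattern {n : ℕ} (S : Finset (Fin n)) (φ : ℕ → ℝ) (G : Equiv.Perm (Fin n) → ℝ)
    (hG : ∀ π, ∀ τ : Equiv.Perm S, G (π * Equiv.Perm.ofSubtype τ) = G π) :
    Ex n (fun π => G π * φ (lisOn π S)) = Ex n G * Ex S.card (fun σ => φ (lisLength σ)) := by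
  have h1 : ∀ τ : Equiv.Perm S, Ex n (fun π => G π * φ (lisOn π S)) =
      Ex n (fun π => G π * φ (lisOn (π * Equiv.Perm.ofSubtype τ) S)) := by
    intro τ
    rw [← Ex_mul_right _ (Equiv.Perm.ofSubtype τ)]
    congr 1
    funext π
    rw [hG]
  have h2 : ∑ τ : Equiv.Perm S, Ex n (fun π => G π * φ (lisOn π S)) =
      ∑ τ : Equiv.Perm S, Ex n (fun π => G π * φ (lisOn (π * Equiv.Perm.ofSubtype τ) S)) :=
    Finset.sum_congr rfl (fun τ _ => h1 τ)
  replace h2 := h2.trans (Ex_sum _ _).symm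
  simp_rw [← Finset.mul_sum, fun π => sum_pattern π S φ] at h2
  simp only [Finset.sum_const, Finset.card_univ, Fintype.card_perm, Fintype.card_coe,
    nsmul_eq_mul] at h2
  have h3 : (S.card.factorial : ℝ) ≠ 0 := by positivity
  have h4 : Ex n (fun π => G π * ∑ σ : Equiv.Perm (Fin S.card), φ (lisLength σ)) =
      Ex n G * ∑ σ : Equiv.Perm (Fin S.card), φ (lisLength σ) := by
    simp_rw [mul_comm (G _)]
    rw [Ex_const_mul, mul_comm]
  rw [h4] at h2
  unfold Ex at h2 ⊢
  field_simp at h2 ⊢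
  linarith

theorem A_nonneg (m : ℕ) : 0 ≤ A m := by
  unfold A; rw [← Ex_const (n := m) 0]; exact Ex_mono (fun π => by positivity)

theorem A_le (m : ℕ) : A m ≤ m := by
  unfold A; rw [← Ex_const (n := m) m]; exact Ex_mono (fun π => by exact_mod_cast lisLength_le π)

theorem A_mono {q N : ℕ} (h : q ≤ N) : A q ≤ A N := by
  obtain ⟨S, -, hS⟩ := Finset.exists_subset_card_eq (s := (Finset.univ : Finset (Fin N))) (n := q)
    (by simpa using h)
  have := Ex_pattern S (fun k => (k : ℝ)) (fun _ => 1) (by simp)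
  rw [Ex_const, hS] at this
  simp only [one_mul] at this
  unfold A
  rw [← this]
  exact Ex_mono (fun π => by exact_mod_cast lisOn_le_lisLength π S)

theorem A_one : A 1 = 1 := by
  have : ∀ σ : Equiv.Perm (Fin 1), lisLength σ = 1 := by
    intro σ
    apply le_antisymm (lisLength_le σ)
    rw [lisLength_eq]
    have := le_lisOn σ Finset.univ Finset.univ (Finset.subset_univ _)
      (by intro i _ j _ hij; omega)
    simpa using this
  unfold A
  simp_rw [this]
  rw [Ex_const]; simp


section moments

variable {n : ℕ} (h : Fin n → ℝ)

theorem Ex_swap (f : Fin n → ℝ) (x y : Fin n) :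
    Ex n (fun π => f (π x)) = Ex n (fun π => f (π y)) := by
  rw [← Ex_mul_right (fun π => f (π x)) (Equiv.swap x y)]
  congr 1
  funext π
  simp

theorem Ex_swap2 (x y z : Fin n) (hy : y ≠ x) (hz : z ≠ x) :
    Ex n (fun π => h (π x) * h (π y)) = Ex n (fun π => h (π x) * h (π z)) := by
  rw [← Ex_mul_right (fun π => h (π x) * h (π y)) (Equiv.swap y z)]
  congr 1
  funext π
  simp [Equiv.swap_apply_of_ne_of_ne hy.symm hz.symm]

theorem cov_nonpos (h0 : ∑ x, h x = 0) (x y : Fin n) (hxy : y ≠ x) :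
    Ex n (fun π => h (π x) * h (π y)) ≤ 0 := by
  by_contra hc
  push Not at hc
  have h1 : 0 < ∑ z ∈ Finset.univ.erase x, Ex n (fun π => h (π x) * h (π z)) := by
    apply Finset.sum_pos
    · intro z hz
      rw [Ex_swap2 h x z y (Finset.ne_of_mem_erase hz) hxy]; exact hc
    · exact ⟨y, by simp [hxy]⟩
  rw [← Ex_sum] at h1
  have h2 : Ex n (fun π => ∑ z ∈ Finset.univ.erase x, h (π x) * h (π z)) ≤ Ex n (fun _ => 0) := by
    apply Ex_mono
    intro π
    rw [← Finset.mul_sum]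
    have : ∑ z ∈ Finset.univ.erase x, h (π z) = - h (π x) := by
      have e := Finset.add_sum_erase Finset.univ (fun z => h (π z)) (Finset.mem_univ x)
      have e2 : ∑ z, h (π z) = 0 := by rw [Equiv.sum_comp π h, h0]
      linarith
    rw [this]
    nlinarith [mul_self_nonneg (h (π x))]
  rw [Ex_const] at h2
  linarith

theorem var_le (h0 : ∑ x, h x = 0) (I : Finset (Fin n)) :
    Ex n (fun π => (∑ x ∈ I, h (π x)) ^ 2) ≤ I.card / n * ∑ x, h x ^ 2 := by
  have h1 : ∀ π : Equiv.Perm (Fin n), (∑ x ∈ I, h (π x)) ^ 2 =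
      ∑ x ∈ I, ∑ y ∈ I, h (π x) * h (π y) := by
    intro π; rw [sq, Finset.sum_mul_sum]
  simp_rw [h1, Ex_sum]
  have hd : ∀ x, Ex n (fun π => h (π x) * h (π x)) = (∑ x, h x ^ 2) / n := by
    intro x
    have hn : (n : ℝ) ≠ 0 := by
      have := x.pos
      positivity
    have e1 : ∑ y : Fin n, Ex n (fun π => h (π y) * h (π y)) =
        ∑ y : Fin n, Ex n (fun π => h (π x) * h (π x)) :=
      Finset.sum_congr rfl (fun y _ => Ex_swap (fun z => h z * h z) y x)
    rw [← Ex_sum] at e1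
    have e2 : ∀ π : Equiv.Perm (Fin n), ∑ y, h (π y) * h (π y) = ∑ y, h y ^ 2 := by
      intro π
      rw [Equiv.sum_comp π (fun y => h y * h y)]
      simp [sq]
    simp_rw [e2] at e1
    rw [Ex_const, Finset.sum_const, Finset.card_univ, Fintype.card_fin, nsmul_eq_mul] at e1
    rw [eq_div_iff hn]
    linarith
  calc ∑ x ∈ I, ∑ y ∈ I, Ex n (fun π => h (π x) * h (π y))
      ≤ ∑ x ∈ I, ∑ y ∈ I, (if x = y then (∑ x, h x ^ 2) / n else 0) := by
        apply Finset.sum_le_sum; intro x hx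
        apply Finset.sum_le_sum; intro y hy
        split_ifs with hxy
        · subst hxy; exact (hd x).le
        · exact cov_nonpos h h0 x y (Ne.symm hxy)
    _ = _ := by
        simp only [Finset.sum_ite_eq]
        rw [← Finset.sum_filter, Finset.sum_const]
        simp
        ring

end moments

theorem var_cell {n : ℕ} (hn : 0 < n) (I : Finset (Fin n)) :
    Ex n (fun π => (((I.filter (fun x => π x ∈ I)).card : ℝ) - (I.card : ℝ) ^ 2 / n) ^ 2) ≤
      (I.card : ℝ) ^ 2 / n := by
  have hn' : (n : ℝ) ≠ 0 := by positivity
  let h : Fin n → ℝ := fun x => (if x ∈ I then 1 else 0) - (I.card : ℝ) / n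
  have h0 : ∑ x, h x = 0 := by
    simp [h, Finset.sum_sub_distrib]
    field_simp; simp
  have h2 : ∑ x, h x ^ 2 ≤ I.card := by
    have : ∀ x, h x ^ 2 = (if x ∈ I then 1 else 0) * (1 - 2 * ((I.card : ℝ) / n))
        + ((I.card : ℝ) / n) ^ 2 := by
      intro x; simp only [h]; split_ifs <;> ring
    simp_rw [this]
    rw [Finset.sum_add_distrib, ← Finset.sum_mul]
    simp
    have e : (n : ℝ) * ((I.card : ℝ) / n) ^ 2 = (I.card : ℝ) * ((I.card : ℝ) / n) := by
      field_simp
    have : 0 ≤ (I.card : ℝ) * ((I.card : ℝ) / n) := by positivity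
    linarith
  have hs : ∀ π : Equiv.Perm (Fin n), ((I.filter (fun x => π x ∈ I)).card : ℝ) -
      (I.card : ℝ) ^ 2 / n = ∑ x ∈ I, h (π x) := by
    intro π
    simp [h, Finset.sum_sub_distrib]
    ring
  simp_rw [hs]
  refine (var_le h h0 I).trans ?_
  calc (I.card : ℝ) / n * ∑ x, h x ^ 2 ≤ (I.card : ℝ) / n * I.card := by gcongr
    _ = _ := by ring

/-- diagonal blocks -/
def blk (n b i : ℕ) : Finset (Fin n) :=
  Finset.univ.filter (fun x => i * b ≤ (x : ℕ) ∧ (x : ℕ) < (i + 1) * b)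

theorem mem_blk {n b i : ℕ} {x : Fin n} :
    x ∈ blk n b i ↔ i * b ≤ (x : ℕ) ∧ (x : ℕ) < (i + 1) * b := by simp [blk]

theorem card_blk {n b i : ℕ} (h : (i + 1) * b ≤ n) : (blk n b i).card = b := by
  have : (blk n b i).map Fin.valEmbedding = Finset.Ico (i * b) ((i + 1) * b) := by
    ext x
    simp only [Finset.mem_map, mem_blk, Fin.valEmbedding_apply, Finset.mem_Ico]
    constructor
    · rintro ⟨y, hy, rfl⟩; exact hy
    · intro hx; exact ⟨⟨x, by omega⟩, hx, rfl⟩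
  rw [← Finset.card_map Fin.valEmbedding, this, Nat.card_Ico, ← Nat.sub_mul]
  simp

theorem blk_lt {n b i j : ℕ} (hij : i < j) {x y : Fin n} (hx : x ∈ blk n b i)
    (hy : y ∈ blk n b j) : x < y := by
  rw [mem_blk] at hx hy
  have : (i + 1) * b ≤ j * b := Nat.mul_le_mul_right _ hij
  rw [Fin.lt_def]; omega

theorem blk_ne {n b i j : ℕ} (hij : i ≠ j) {x : Fin n} (hx : x ∈ blk n b i) :
    x ∉ blk n b j := by
  intro hy
  rcases lt_or_gt_of_ne hij with h | h
  · exact lt_irrefl _ (blk_lt h hx hy)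
  · exact lt_irrefl _ (blk_lt h hy hx)

/-- points in a diagonal cell -/
noncomputable def cell (n b i : ℕ) (π : Equiv.Perm (Fin n)) : Finset (Fin n) :=
  (blk n b i).filter (fun x => π x ∈ blk n b i)

theorem sum_cells_le {n b k : ℕ} (π : Equiv.Perm (Fin n)) :
    ∑ i ∈ Finset.range k, lisOn π (cell n b i π) ≤ lisLength π := by
  choose s hs h' hc using fun i => exists_lisOn π (cell n b i π)
  have hblk : ∀ i x, x ∈ s i → x ∈ blk n b i ∧ π x ∈ blk n b i := by
    intro i x hx
    have := hs i hx
    simpa [cell] using this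
  have : ((Finset.range k).biUnion s).card = ∑ i ∈ Finset.range k, lisOn π (cell n b i π) := by
    rw [Finset.card_biUnion]
    · exact Finset.sum_congr rfl (fun i _ => hc i)
    · intro i _ j _ hij
      change Disjoint (s i) (s j)
      rw [Finset.disjoint_left]
      intro x hx hy
      exact blk_ne hij (hblk i x hx).1 (hblk j x hy).1
  rw [← this, lisLength_eq]
  apply le_lisOn _ _ _ (Finset.subset_univ _)
  intro x hx y hy hxy
  simp only [Finset.mem_biUnion] at hx hy
  obtain ⟨i, -, hi⟩ := hx
  obtain ⟨j, -, hj⟩ := hy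
  rcases lt_trichotomy i j with h | h | h
  · exact blk_lt h (hblk i x hi).2 (hblk j y hj).2
  · subst h; exact h' i x hi y hj hxy
  · exact absurd (blk_lt h (hblk j y hj).1 (hblk i x hi).1) (not_lt.mpr hxy.le)

theorem ofSubtype_ne {n : ℕ} {S : Finset (Fin n)} (τ : Equiv.Perm S) {x : Fin n} (hx : x ∉ S) :
    Equiv.Perm.ofSubtype τ x = x := Equiv.Perm.ofSubtype_apply_of_not_mem τ hx

theorem ofSubtype_mem {n : ℕ} {S : Finset (Fin n)} (τ : Equiv.Perm S) {x : Fin n} (hx : x ∈ S) :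
    Equiv.Perm.ofSubtype τ x ∈ S := by
  rw [Equiv.Perm.ofSubtype_apply_of_mem τ hx]; exact (τ ⟨x, hx⟩).2

theorem mem_cell {n b i : ℕ} {π : Equiv.Perm (Fin n)} {x : Fin n} :
    x ∈ cell n b i π ↔ x ∈ blk n b i ∧ π x ∈ blk n b i := by simp [cell]

theorem cell_inv {n b i : ℕ} (π : Equiv.Perm (Fin n)) {S : Finset (Fin n)} (hS : cell n b i π = S)
    (τ : Equiv.Perm S) : cell n b i (π * Equiv.Perm.ofSubtype τ) = S := by
  refine Eq.trans ?_ hS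
  ext x
  have hm : ∀ y, y ∈ S ↔ y ∈ blk n b i ∧ π y ∈ blk n b i := by
    intro y; rw [← mem_cell, hS]
  rw [mem_cell, mem_cell, Equiv.Perm.mul_apply]
  by_cases hx : x ∈ S
  · have h1 := (hm _).mp (ofSubtype_mem τ hx)
    have h2 := (hm _).mp hx
    tauto
  · rw [ofSubtype_ne τ hx]

theorem cell_inv_iff {n b i : ℕ} (π : Equiv.Perm (Fin n)) {S : Finset (Fin n)}
    (τ : Equiv.Perm S) : cell n b i (π * Equiv.Perm.ofSubtype τ) = S ↔ cell n b i π = S := by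
  constructor
  · intro h
    have := cell_inv _ h τ⁻¹
    rwa [mul_assoc, ← map_mul, mul_inv_cancel, map_one, mul_one] at this
  · intro h; exact cell_inv π h τ

theorem cell_other {n b i j : ℕ} (hij : i ≠ j) (π : Equiv.Perm (Fin n)) {S : Finset (Fin n)}
    (hS : cell n b i π = S) (τ : Equiv.Perm S) :
    cell n b j (π * Equiv.Perm.ofSubtype τ) = cell n b j π ∧
    lisOn (π * Equiv.Perm.ofSubtype τ) (cell n b j π) = lisOn π (cell n b j π) := by
  have key : ∀ x ∈ blk n b j, Equiv.Perm.ofSubtype τ x = x := by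
    intro x hx
    apply ofSubtype_ne
    rw [← hS]
    intro h
    exact blk_ne hij (Finset.mem_filter.mp h).1 hx
  constructor
  · unfold cell
    apply Finset.filter_congr
    intro x hx
    rw [Equiv.Perm.mul_apply, key x hx]
  · apply lisOn_congr
    intro x hx
    rw [Equiv.Perm.mul_apply, key x (Finset.mem_filter.mp hx).1]

/-- centred cell contribution -/
noncomputable def Z (n b i : ℕ) (π : Equiv.Perm (Fin n)) : ℝ :=
  (lisOn π (cell n b i π) : ℝ) - A (cell n b i π).card

theorem cross {n b i j : ℕ} (hij : i ≠ j) : Ex n (fun π => Z n b j π * Z n b i π) = 0 := by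
  have h1 : ∀ π, Z n b j π * Z n b i π = ∑ S : Finset (Fin n),
      (if cell n b i π = S then Z n b j π else 0) * ((lisOn π S : ℝ) - A S.card) := by
    intro π
    simp [Z]
  simp_rw [h1]
  rw [Ex_sum]
  apply Finset.sum_eq_zero
  intro S _
  rw [Ex_pattern S (fun k => (k : ℝ) - A S.card)]
  · have : Ex S.card (fun σ => (lisLength σ : ℝ) - A S.card) = 0 := by
      simp_rw [sub_eq_add_neg]
      rw [Ex_add, Ex_const]
      simp [A]
    rw [this, mul_zero]
  · intro π τ
    by_cases h : cell n b i π = S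
    · rw [if_pos h, if_pos ((cell_inv_iff π τ).mpr h)]
      obtain ⟨e1, e2⟩ := cell_other hij π h τ
      unfold Z
      rw [e1, e2]
    · rw [if_neg h, if_neg (fun h' => h ((cell_inv_iff π τ).mp h'))]

theorem Z_sq_le {n b i : ℕ} (π : Equiv.Perm (Fin n)) :
    Z n b i π ^ 2 ≤ ((cell n b i π).card : ℝ) ^ 2 := by
  have h1 : (lisOn π (cell n b i π) : ℝ) ≤ (cell n b i π).card := by
    exact_mod_cast lisOn_le_card π _
  have h2 := A_le (cell n b i π).card
  have h3 := A_nonneg (cell n b i π).card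
  have h4 : (0:ℝ) ≤ (lisOn π (cell n b i π) : ℝ) := by positivity
  unfold Z
  apply sq_le_sq'  <;> linarith

theorem main_bound {n b k q : ℕ} {μ : ℝ} (hn : 0 < n) (hk : k * b ≤ n) (hμ : μ = (b : ℝ) ^ 2 / n)
    (hq : (q : ℝ) < μ) :
    Ex n (fun π => max (k * A q - lisLength π) 0) ≤
      Real.sqrt (k * (2 * μ + 2 * μ ^ 2)) + k * A q * (μ / (μ - q) ^ 2) := by
  have hμ0 : 0 ≤ μ := by rw [hμ]; positivity
  have hvar : ∀ i ∈ Finset.range k,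
      Ex n (fun π => (((cell n b i π).card : ℝ) - μ) ^ 2) ≤ μ := by
    intro i hi
    have hc : (blk n b i).card = b := card_blk
      ((Nat.mul_le_mul_right _ (Finset.mem_range.mp hi)).trans hk)
    have := var_cell hn (blk n b i)
    rw [hc, ← hμ] at this
    exact this
  have hD : Ex n (fun π => (∑ i ∈ Finset.range k, Z n b i π) ^ 2) ≤ k * (2 * μ + 2 * μ ^ 2) := by
    have h1 : ∀ π : Equiv.Perm (Fin n), (∑ i ∈ Finset.range k, Z n b i π) ^ 2 =
        ∑ i ∈ Finset.range k, ∑ j ∈ Finset.range k, Z n b i π * Z n b j π := by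
      intro π; rw [sq, Finset.sum_mul_sum]
    simp_rw [h1, Ex_sum]
    calc _ ≤ ∑ i ∈ Finset.range k, ∑ j ∈ Finset.range k,
          (if i = j then (2 * μ + 2 * μ ^ 2) else 0) := by
          apply Finset.sum_le_sum; intro i hi
          apply Finset.sum_le_sum; intro j hj
          split_ifs with hij
          · subst hij
            have : ∀ π, Z n b i π * Z n b i π ≤ 2 * (((cell n b i π).card : ℝ) - μ) ^ 2 +
                2 * μ ^ 2 := by
              intro π
              have := Z_sq_le (b := b) (i := i) π
              nlinarith [sq_nonneg (((cell n b i π).card : ℝ) - 2 * μ)]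
            refine (Ex_mono this).trans ?_
            rw [Ex_add, Ex_const, Ex_const_mul]
            linarith [hvar i hi]
          · exact (cross (Ne.symm hij)).le
      _ = _ := by
          simp only [Finset.sum_ite_eq]
          rw [← Finset.sum_filter, Finset.sum_const, Finset.filter_mem_eq_inter,
            Finset.inter_self, Finset.card_range, nsmul_eq_mul]
  have hD1 : Ex n (fun π => |∑ i ∈ Finset.range k, Z n b i π|) ≤
      Real.sqrt (k * (2 * μ + 2 * μ ^ 2)) := by
    apply Real.le_sqrt_of_sq_le
    refine (sq_Ex_le _).trans ?_
    simpa only [sq_abs] using hD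
  have hpt : ∀ π : Equiv.Perm (Fin n), max (k * A q - lisLength π) 0 ≤
      |∑ i ∈ Finset.range k, Z n b i π| + ∑ i ∈ Finset.range k,
        (A q / (μ - q) ^ 2) * (((cell n b i π).card : ℝ) - μ) ^ 2 := by
    intro π
    have hq2 : 0 < (μ - q) ^ 2 := by have : 0 < μ - q := by linarith
                                     positivity
    have hAq := A_nonneg q
    have hnn : 0 ≤ ∑ i ∈ Finset.range k,
        (A q / (μ - q) ^ 2) * (((cell n b i π).card : ℝ) - μ) ^ 2 :=
      Finset.sum_nonneg (fun i _ => by positivity)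
    apply max_le
    · have h1 : ∀ i, A q - A (cell n b i π).card ≤
          (A q / (μ - q) ^ 2) * (((cell n b i π).card : ℝ) - μ) ^ 2 := by
        intro i
        by_cases hc : q ≤ (cell n b i π).card
        · have := A_mono hc
          have : 0 ≤ (A q / (μ - q) ^ 2) * (((cell n b i π).card : ℝ) - μ) ^ 2 := by positivity
          linarith
        · have h0 := A_nonneg (cell n b i π).card
          have hc' : ((cell n b i π).card : ℝ) ≤ q := by exact_mod_cast (not_le.mp hc).le
          have : (μ - q) ^ 2 ≤ (((cell n b i π).card : ℝ) - μ) ^ 2 := by nlinarith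
          have : A q ≤ (A q / (μ - q) ^ 2) * (((cell n b i π).card : ℝ) - μ) ^ 2 := by
            calc A q = (A q / (μ - q) ^ 2) * (μ - q) ^ 2  := by
                  rw [div_mul_cancel₀ _ hq2.ne']
              _ ≤ _ := by gcongr
          linarith
      have h2 : ∑ i ∈ Finset.range k, (A q - A (cell n b i π).card) ≤ _ :=
        Finset.sum_le_sum (fun i _ => h1 i)
      have h3 : (∑ i ∈ Finset.range k, (lisOn π (cell n b i π) : ℝ)) ≤ lisLength π := by
        exact_mod_cast sum_cells_le (b := b) (k := k) π
      have h4 := neg_abs_le (∑ i ∈ Finset.range k, Z n b i π)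
      simp only [Z, Finset.sum_sub_distrib, Finset.sum_const, Finset.card_range,
        nsmul_eq_mul] at h2 h4 ⊢
      linarith
    · positivity
  refine (Ex_mono hpt).trans ?_
  rw [Ex_add, Ex_sum]
  refine add_le_add hD1 ?_
  calc _ ≤ ∑ i ∈ Finset.range k, (A q / (μ - q) ^ 2) * μ := by
        apply Finset.sum_le_sum
        intro i hi
        rw [Ex_const_mul]
        have := A_nonneg q
        exact mul_le_mul_of_nonneg_left (hvar i hi) (by positivity)
    _ = _ := by
        rw [Finset.sum_const, Finset.card_range, nsmul_eq_mul]; ring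

theorem lisLength_full {K : ℕ} (σ : Equiv.Perm (Fin K)) (h : lisLength σ = K) : σ = 1 := by
  rw [lisLength_eq] at h
  obtain ⟨s, -, h', hc⟩ := exists_lisOn σ Finset.univ
  rw [h] at hc
  have hs : s = Finset.univ := by
    rw [← Finset.card_eq_iff_eq_univ, hc, Fintype.card_fin]
  have hm : StrictMono σ := fun i j hij => h' i (by simp [hs]) j (by simp [hs]) hij
  let e : Fin K ≃o Fin K := hm.orderIsoOfSurjective σ σ.surjective
  have he : e = OrderIso.refl _ := Subsingleton.elim _ _
  ext x
  have : e x = x := by rw [he]; rfl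
  exact congrArg Fin.val this

theorem Ex_full_le (K : ℕ) :
    Ex K (fun σ => if lisLength σ = K then (1:ℝ) else 0) ≤ 1 / (K.factorial : ℝ) := by
  unfold Ex
  gcongr
  rw [← Finset.sum_filter, Finset.sum_const, nsmul_eq_mul, mul_one]
  have : (Finset.univ.filter (fun σ : Equiv.Perm (Fin K) => lisLength σ = K)) ⊆ {1} := by
    intro σ hσ
    simp only [Finset.mem_filter, Finset.mem_univ, true_and] at hσ
    simp [lisLength_full σ hσ]
  exact_mod_cast (Finset.card_le_card this).trans (by simp)

theorem Ex_tail_le (n K : ℕ) :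
    Ex n (fun π => if K ≤ lisLength π then (1:ℝ) else 0) ≤
      (n.choose K : ℝ) / (K.factorial : ℝ) := by
  have h1 : ∀ π : Equiv.Perm (Fin n), (if K ≤ lisLength π then (1:ℝ) else 0) ≤
      ∑ s ∈ Finset.powersetCard K Finset.univ, (1 : ℝ) * (if lisOn π s = K then (1:ℝ) else 0) := by
    intro π
    split_ifs with h
    · rw [lisLength_eq] at h
      obtain ⟨t, -, h', hc⟩ := exists_lisOn π Finset.univ
      rw [← hc] at h
      obtain ⟨s, hst, hs⟩ := Finset.exists_subset_card_eq h
      have h2 : lisOn π s = K := by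
        apply le_antisymm
        · rw [← hs]; exact lisOn_le_card π s
        · conv_lhs => rw [← hs]
          exact le_lisOn π s s (le_refl _) (fun i hi j hj => h' i (hst hi) j (hst hj))
      have := Finset.single_le_sum (s := Finset.powersetCard K Finset.univ)
        (f := fun s => (1 : ℝ) * (if lisOn π s = K then (1:ℝ) else 0))
        (fun i _ => by split_ifs <;> simp) (a := s) (by simp [hs])
      simpa [h2] using this
    · exact Finset.sum_nonneg (fun i _ => by split_ifs <;> simp)
  refine (Ex_mono h1).trans ?_
  rw [Ex_sum]
  calc _ ≤ ∑ s ∈ Finset.powersetCard K (Finset.univ : Finset (Fin n)),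
        1 / (K.factorial : ℝ) := by
        apply Finset.sum_le_sum
        intro s hs
        rw [Ex_pattern s (fun k => if k = K then (1:ℝ) else 0) (fun _ => 1) (by simp), Ex_const,
          one_mul]
        have hs' : s.card = K := by simpa using hs
        subst hs'
        exact Ex_full_le _
    _ = _ := by
        rw [Finset.sum_const, Finset.card_powersetCard, Finset.card_univ, Fintype.card_fin,
          nsmul_eq_mul]
        ring

theorem A_upper (n : ℕ) (hn : 0 < n) : A n ≤ 8 * Real.sqrt n := by
  set r := Real.sqrt n with hr
  have hn1 : (1:ℝ) ≤ n := by exact_mod_cast hn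
  have hr1 : 1 ≤ r := by rw [hr]; exact Real.one_le_sqrt.mpr hn1
  have hrr : r * r = n := Real.mul_self_sqrt (by positivity)
  set K := ⌈6 * r⌉₊ with hK
  have hK1 : 6 * r ≤ K := Nat.le_ceil _
  have hK2 : (K : ℝ) < 6 * r + 1 := Nat.ceil_lt_add_one (by positivity)
  have hKpos : (0:ℝ) < K := by linarith
  have hb : A n ≤ K + n * ((n.choose K : ℝ) / (K.factorial : ℝ)) := by
    have : A n ≤ Ex n (fun π => (K : ℝ) + n * (if K ≤ lisLength π then (1:ℝ) else 0)) := by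
      apply Ex_mono
      intro π
      split_ifs with h
      · have : (lisLength π : ℝ) ≤ n := by exact_mod_cast lisLength_le π
        linarith
      · have : (lisLength π : ℝ) ≤ K := by exact_mod_cast (not_le.mp h).le
        linarith
    refine this.trans ?_
    rw [Ex_add, Ex_const, Ex_const_mul]
    have := Ex_tail_le n K
    gcongr
  have hfac : (0:ℝ) < (K.factorial : ℝ) := by positivity
  have h1 : (n.choose K : ℝ) ≤ (n : ℝ) ^ K / (K.factorial : ℝ) := Nat.choose_le_pow_div K n
  have h2 : (K : ℝ) ^ K / (K.factorial : ℝ) ≤ 3 ^ K := by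
    refine (Real.pow_div_factorial_le_exp K hKpos.le K).trans ?_
    have : Real.exp (K : ℝ) = Real.exp 1 ^ K := by rw [← Real.exp_nat_mul]; simp
    rw [this]
    have := Real.exp_one_lt_d9
    gcongr
    linarith
  have h3 : (n.choose K : ℝ) / (K.factorial : ℝ) ≤ (1 / 4) ^ K := by
    have e1 : (6 * r) ^ K / (K.factorial : ℝ) ≤ 3 ^ K := by
      refine le_trans ?_ h2
      gcongr
    have e2 : r ^ K / (K.factorial : ℝ) ≤ (1 / 2) ^ K := by
      have : (6 * r) ^ K = 6 ^ K * r ^ K := mul_pow _ _ _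
      rw [this] at e1
      have h6 : (3:ℝ) ^ K = 6 ^ K * (1 / 2) ^ K := by rw [← mul_pow]; norm_num
      rw [h6, mul_div_assoc] at e1
      exact le_of_mul_le_mul_left e1 (by positivity)
    calc (n.choose K : ℝ) / (K.factorial : ℝ)
        ≤ ((n : ℝ) ^ K / (K.factorial : ℝ)) / (K.factorial : ℝ) := by gcongr
      _ = (r ^ K / (K.factorial : ℝ)) * (r ^ K / (K.factorial : ℝ)) := by
          rw [← hrr, mul_pow]; field_simp
      _ ≤ (1 / 2) ^ K * (1 / 2) ^ K := by gcongr
      _ = (1 / 4) ^ K := by rw [← mul_pow]; norm_num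
  have h4 : ((1:ℝ) / 4) ^ K ≤ 1 / K := by
    rw [div_pow, one_pow]
    have : K < 4 ^ K := Nat.lt_pow_self (by norm_num)
    have : (K : ℝ) ≤ 4 ^ K := by exact_mod_cast this.le
    gcongr
  have h5 : (n : ℝ) * ((n.choose K : ℝ) / (K.factorial : ℝ)) ≤ r := by
    calc (n : ℝ) * ((n.choose K : ℝ) / (K.factorial : ℝ)) ≤ n * (1 / K) := by
          exact mul_le_mul_of_nonneg_left (h3.trans h4) (by positivity)
      _ ≤ r := by
          rw [mul_one_div, div_le_iff₀ hKpos]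
          nlinarith
  linarith

theorem asym (q : ℕ) (s ε : ℝ) (hs : 0 < s) (hq : (q : ℝ) < s ^ 2) (hε : 0 < ε) :
    ∀ᶠ n : ℕ in atTop, Ex n (fun π => max (A q / s - lisLength π / Real.sqrt n) 0) ≤
      A q / s * (s ^ 2 / (s ^ 2 - q) ^ 2) + ε := by
  have hsq : Tendsto (fun n : ℕ => Real.sqrt n) atTop atTop :=
    Real.tendsto_sqrt_atTop.comp tendsto_natCast_atTop_atTop
  let b : ℕ → ℕ := fun n => ⌊s * Real.sqrt n⌋₊
  let k : ℕ → ℕ := fun n => ⌊s⁻¹ * Real.sqrt n⌋₊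
  have hb : Tendsto (fun n => (b n : ℝ) / Real.sqrt n) atTop (nhds s) :=
    (tendsto_nat_floor_mul_div_atTop (R := ℝ) hs.le).comp hsq
  have hk : Tendsto (fun n => (k n : ℝ) / Real.sqrt n) atTop (nhds s⁻¹) :=
    (tendsto_nat_floor_mul_div_atTop (R := ℝ) (inv_nonneg.mpr hs.le)).comp hsq
  let μ : ℕ → ℝ := fun n => (b n : ℝ) ^ 2 / n
  have hμ : Tendsto μ atTop (nhds (s ^ 2)) := by
    refine (hb.pow 2).congr ?_
    intro n
    simp only [μ]
    rw [div_pow, Real.sq_sqrt (by positivity)]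
  have hinv : Tendsto (fun n : ℕ => (Real.sqrt n)⁻¹) atTop (nhds 0) :=
    tendsto_inv_atTop_zero.comp hsq
  have hne : (s ^ 2 - (q:ℝ)) ^ 2 ≠ 0 := by
    have : 0 < s ^ 2 - (q:ℝ) := by linarith
    positivity
  let R : ℕ → ℝ := fun n => (A q / s - (k n : ℝ) / Real.sqrt n * A q) +
    (Real.sqrt ((k n : ℝ) / Real.sqrt n * (2 * μ n + 2 * μ n ^ 2) * (Real.sqrt n)⁻¹) +
      (k n : ℝ) / Real.sqrt n * A q * (μ n / (μ n - q) ^ 2))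
  have hR : Tendsto R atTop (nhds ((A q / s - s⁻¹ * A q) +
      (Real.sqrt (s⁻¹ * (2 * s ^ 2 + 2 * (s ^ 2) ^ 2) * 0) +
      s⁻¹ * A q * (s ^ 2 / (s ^ 2 - q) ^ 2)))) := by
    refine Tendsto.add (tendsto_const_nhds.sub (hk.mul_const _)) (Tendsto.add ?_ ?_)
    · exact (((hk.mul ((hμ.const_mul 2).add ((hμ.pow 2).const_mul 2))).mul hinv)).sqrt
    · exact (hk.mul_const _).mul (hμ.div ((hμ.sub_const _).pow 2) hne)
  have hlim : (A q / s - s⁻¹ * A q) +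
      (Real.sqrt (s⁻¹ * (2 * s ^ 2 + 2 * (s ^ 2) ^ 2) * 0) +
      s⁻¹ * A q * (s ^ 2 / (s ^ 2 - q) ^ 2)) = A q / s * (s ^ 2 / (s ^ 2 - q) ^ 2) := by
    rw [mul_zero, Real.sqrt_zero]; ring
  rw [hlim] at hR
  have hev := hR.eventually_le_const (show A q / s * (s ^ 2 / (s ^ 2 - q) ^ 2) <
    A q / s * (s ^ 2 / (s ^ 2 - q) ^ 2) + ε by linarith)
  have hμev := hμ.eventually_const_lt hq
  filter_upwards [hev, hμev, eventually_gt_atTop 0] with n h1 h2 h3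
  refine le_trans ?_ h1
  have hn : (0:ℝ) < n := by exact_mod_cast h3
  have hr : 0 < Real.sqrt n := Real.sqrt_pos.mpr hn
  have hrr : Real.sqrt n * Real.sqrt n = n := Real.mul_self_sqrt hn.le
  have hk1 : (k n : ℝ) ≤ s⁻¹ * Real.sqrt n := Nat.floor_le (by positivity)
  have hb1 : (b n : ℝ) ≤ s * Real.sqrt n := Nat.floor_le (by positivity)
  have hkb : k n * b n ≤ n := by
    have : (k n : ℝ) * b n ≤ n := by
      calc (k n : ℝ) * b n ≤ (s⁻¹ * Real.sqrt n) * (s * Real.sqrt n) := by gcongr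
        _ = s⁻¹ * s * (Real.sqrt n * Real.sqrt n) := by ring
        _ = n := by rw [hrr, inv_mul_cancel₀ hs.ne', one_mul]
    exact_mod_cast this
  have hmain := main_bound (q := q) h3 hkb (μ := μ n) rfl h2
  have hpt : ∀ π : Equiv.Perm (Fin n), max (A q / s - lisLength π / Real.sqrt n) 0 ≤
      (A q / s - (k n : ℝ) / Real.sqrt n * A q) +
        (Real.sqrt n)⁻¹ * max (k n * A q - lisLength π) 0 := by
    intro π
    have hA := A_nonneg q
    have e1 : (k n : ℝ) / Real.sqrt n * A q ≤ A q / s := by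
      have : (k n : ℝ) / Real.sqrt n ≤ s⁻¹ := by rw [div_le_iff₀ hr]; exact hk1
      calc _ ≤ s⁻¹ * A q := by gcongr
        _ = _ := by ring
    apply max_le
    · have := mul_le_mul_of_nonneg_left (le_max_left (k n * A q - (lisLength π : ℝ)) 0)
        (inv_nonneg.mpr hr.le)
      have e : (Real.sqrt n)⁻¹ * (k n * A q - (lisLength π : ℝ)) =
        (k n : ℝ) / Real.sqrt n * A q - lisLength π / Real.sqrt n := by ring
      linarith
    · have : 0 ≤ (Real.sqrt n)⁻¹ * max (k n * A q - (lisLength π : ℝ)) 0 := by positivity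
      linarith
  refine (Ex_mono hpt).trans ?_
  rw [Ex_add, Ex_const, Ex_const_mul]
  simp only [R]
  have hfin := mul_le_mul_of_nonneg_left hmain (inv_nonneg.mpr hr.le)
  have e2 : Real.sqrt ((k n : ℝ) / Real.sqrt n * (2 * μ n + 2 * μ n ^ 2) * (Real.sqrt n)⁻¹) =
      (Real.sqrt n)⁻¹ * Real.sqrt (k n * (2 * μ n + 2 * μ n ^ 2)) := by
    have : (k n : ℝ) / Real.sqrt n * (2 * μ n + 2 * μ n ^ 2) * (Real.sqrt n)⁻¹ =
        ((Real.sqrt n)⁻¹) ^ 2 * (k n * (2 * μ n + 2 * μ n ^ 2)) := by ring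
    rw [this, Real.sqrt_mul (by positivity), Real.sqrt_sq (by positivity)]
  rw [e2]
  have e3 : (Real.sqrt n)⁻¹ * (Real.sqrt (k n * (2 * μ n + 2 * μ n ^ 2)) +
      k n * A q * (μ n / (μ n - q) ^ 2)) =
      (Real.sqrt n)⁻¹ * Real.sqrt (k n * (2 * μ n + 2 * μ n ^ 2)) +
      (k n : ℝ) / Real.sqrt n * A q * (μ n / (μ n - q) ^ 2) := by ring
  rw [e3] at hfin
  linarith

/-- normalized expected length -/
noncomputable def r (n : ℕ) : ℝ := A n / Real.sqrt n

theorem r_nonneg (n : ℕ) : 0 ≤ r n := div_nonneg (A_nonneg n) (Real.sqrt_nonneg _)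

theorem r_le (n : ℕ) : r n ≤ 8 := by
  unfold r
  rcases Nat.eq_zero_or_pos n with h | h
  · subst h; simp
  · rw [div_le_iff₀ (Real.sqrt_pos.mpr (by exact_mod_cast h))]
    exact A_upper n h

theorem Ex_lis (n : ℕ) : Ex n (fun π => lisLength π / Real.sqrt n) = r n := by
  unfold r A
  simp_rw [div_eq_inv_mul]
  rw [Ex_const_mul]

theorem key (ε : ℝ) (hε : 0 < ε) : ∃ Q : ℕ, ∀ q ≥ Q, ∀ᶠ n : ℕ in atTop,
    Ex n (fun π => max (r q - ε - lisLength π / Real.sqrt n) 0) ≤ ε := by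
  set δ := ε / 8 with hδ
  have hδ0 : 0 < δ := by positivity
  obtain ⟨Q, hQ⟩ := exists_nat_gt (max 1 (8 * (1 + δ) ^ 2 / (4 * δ ^ 2) / (ε / 2)))
  refine ⟨Q, fun q hq => ?_⟩
  have hqQ : (Q : ℝ) ≤ q := by exact_mod_cast hq
  have hq1 : (1:ℝ) < q := lt_of_lt_of_le (lt_of_le_of_lt (le_max_left _ _) hQ) hqQ
  have hq2 : 8 * (1 + δ) ^ 2 / (4 * δ ^ 2) / (ε / 2) < q :=
    lt_of_lt_of_le (lt_of_le_of_lt (le_max_right _ _) hQ) hqQ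
  have hsq : 0 < Real.sqrt q := Real.sqrt_pos.mpr (by linarith)
  have hs2 : ((1 + δ) * Real.sqrt q) ^ 2 = (1 + δ) ^ 2 * q := by
    rw [mul_pow, Real.sq_sqrt (by linarith)]
  have hlt : (q : ℝ) < ((1 + δ) * Real.sqrt q) ^ 2 := by
    rw [hs2]; nlinarith
  have hr0 := r_nonneg q
  have hr8 := r_le q
  have hAs : A q / ((1 + δ) * Real.sqrt q) = r q / (1 + δ) := by
    unfold r; rw [div_div, mul_comm]
  filter_upwards [asym q ((1 + δ) * Real.sqrt q) (ε / 2) (by positivity) hlt (by positivity)]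
    with n hn
  rw [hAs, hs2] at hn
  have h1 : r q - ε ≤ r q / (1 + δ) := by
    rw [le_div_iff₀ (by positivity)]
    nlinarith [mul_pos hε hδ0]
  have h2 : r q / (1 + δ) * ((1 + δ) ^ 2 * q / ((1 + δ) ^ 2 * q - q) ^ 2) ≤ ε / 2 := by
    have a1 : r q / (1 + δ) ≤ 8 := by
      rw [div_le_iff₀ (by positivity)]; nlinarith
    have a2 : (4 * δ ^ 2) * q ^ 2 ≤ ((1 + δ) ^ 2 * q - q) ^ 2 := by
      have : (2 * δ * q) ^ 2 ≤ ((1 + δ) ^ 2 * q - q) ^ 2 := by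
        apply pow_le_pow_left₀ (by positivity)
        nlinarith [sq_nonneg δ]
      nlinarith
    calc r q / (1 + δ) * ((1 + δ) ^ 2 * q / ((1 + δ) ^ 2 * q - q) ^ 2)
        ≤ 8 * ((1 + δ) ^ 2 * q / ((4 * δ ^ 2) * q ^ 2)) := by gcongr
      _ = 8 * (1 + δ) ^ 2 / (4 * δ ^ 2) / q := by field_simp
      _ ≤ ε / 2 := by
        rw [div_lt_iff₀ (by positivity)] at hq2
        rw [div_le_iff₀ (by positivity)]; linarith
  have h3 : Ex n (fun π => max (r q - ε - lisLength π / Real.sqrt n) 0) ≤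
      Ex n (fun π => max (r q / (1 + δ) - lisLength π / Real.sqrt n) 0) := by
    apply Ex_mono; intro π
    gcongr
  linarith

theorem r_pos_ev : ∀ᶠ n : ℕ in atTop, (1:ℝ) / 10 ≤ r n := by
  filter_upwards [asym 1 3 (1 / 10) (by norm_num) (by norm_num) (by norm_num)] with n hn
  rw [A_one] at hn
  have h1 : Ex n (fun _ => (1:ℝ) / 3) ≤ Ex n (fun π => max (1 / 3 - lisLength π / Real.sqrt n) 0 +
      lisLength π / Real.sqrt n) := by
    apply Ex_mono; intro π
    have := le_max_left ((1:ℝ) / 3 - lisLength π / Real.sqrt n) 0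
    linarith
  rw [Ex_add, Ex_const, Ex_lis] at h1
  norm_num at hn h1 ⊢
  linarith

theorem exists_limit : ∃ c : ℝ, 0 < c ∧ ∀ ε > 0, ∀ᶠ n : ℕ in atTop,
    Ex n (fun π => |lisLength π / Real.sqrt n - c|) ≤ ε := by
  have hbdd : IsBoundedUnder (· ≤ ·) atTop r := isBoundedUnder_of ⟨8, r_le⟩
  have hbdd2 : IsBoundedUnder (· ≥ ·) atTop r := isBoundedUnder_of ⟨0, r_nonneg⟩
  have hcob : IsCoboundedUnder (· ≤ ·) atTop r := hbdd2.isCoboundedUnder_le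
  refine ⟨limsup r atTop, ?_, ?_⟩
  · have : (1:ℝ) / 10 ≤ limsup r atTop :=
      le_limsup_of_frequently_le r_pos_ev.frequently hbdd
    linarith
  · intro ε hε
    set c := limsup r atTop with hc
    set η := ε / 10 with hη
    have hη0 : 0 < η := by positivity
    obtain ⟨Q, hQ⟩ := key η hη0
    have hfreq : ∃ᶠ q in atTop, c - η < r q :=
      frequently_lt_of_lt_limsup hcob (by rw [← hc]; linarith)
    obtain ⟨q, hq, hqc⟩ := (frequently_atTop.mp hfreq) Q
    have hup : ∀ᶠ n in atTop, r n < c + η :=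
      eventually_lt_of_limsup_lt (by rw [← hc]; linarith) hbdd
    filter_upwards [hQ q hq, hup] with n h1 h2
    have hpt : ∀ π : Equiv.Perm (Fin n), |lisLength π / Real.sqrt n - c| ≤
        (lisLength π / Real.sqrt n + (4 * η - c)) +
          2 * max (r q - η - lisLength π / Real.sqrt n) 0 := by
      intro π
      have m1 := le_max_left (r q - η - lisLength π / Real.sqrt n) 0
      have m2 := le_max_right (r q - η - lisLength π / Real.sqrt n) 0
      apply abs_le.mpr
      constructor <;> linarith
    refine (Ex_mono hpt).trans ?_
    rw [Ex_add, Ex_add, Ex_const, Ex_const_mul, Ex_lis]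
    linarith

theorem measure_le (n : ℕ) (f : Equiv.Perm (Fin n) → ℝ) (ε : ℝ) (hε : 0 < ε) :
    uniformPerm n {π | ε < |f π|} ≤ ENNReal.ofReal (Ex n (fun π => |f π|) / ε) := by
  unfold uniformPerm
  rw [PMF.toMeasure_uniformOfFintype_apply {π : Equiv.Perm (Fin n) | ε < |f π|}
    (MeasurableSpace.measurableSet_top)]
  have hcard : (Fintype.card {π : Equiv.Perm (Fin n) | ε < |f π|} : ℝ) * ε ≤ ∑ π, |f π| := by
    rw [← Set.toFinset_card, ← nsmul_eq_mul, ← Finset.sum_const]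
    refine (Finset.sum_le_sum ?_).trans (Finset.sum_le_univ_sum_of_nonneg (fun π => abs_nonneg (f π)))
    intro π hπ
    simp only [Set.mem_toFinset, Set.mem_setOf_eq] at hπ
    exact hπ.le
  rw [Fintype.card_perm, Fintype.card_fin]
  have hf : (0:ℝ) < (n.factorial : ℝ) := by positivity
  have : ((Fintype.card {π : Equiv.Perm (Fin n) | ε < |f π|} : ENNReal)) / (n.factorial : ENNReal)
      = ENNReal.ofReal ((Fintype.card {π : Equiv.Perm (Fin n) | ε < |f π|} : ℝ) / n.factorial) := by
    rw [ENNReal.ofReal_div_of_pos hf, ENNReal.ofReal_natCast, ENNReal.ofReal_natCast]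
  rw [this]
  apply ENNReal.ofReal_le_ofReal
  unfold Ex
  rw [le_div_iff₀ hε, div_mul_eq_mul_div]
  gcongr

end Ulam

/-- (Hammersley, the Ulam problem) There is a constant `c > 0` such that the
length `ℓ_n` of the longest increasing subsequence of a uniformly random
permutation of `{1, …, n}` satisfies `ℓ_n / √n → c` in probability. -/
theorem ulam_problem :
    ∃ c : ℝ, 0 < c ∧
      ∀ ε : ℝ, 0 < ε →
        Tendsto
          (fun n : ℕ =>
            uniformPerm n {π | ε < |(lisLength π : ℝ) / Real.sqrt n - c|})
          atTop (nhds 0) := by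
  obtain ⟨c, hc, h⟩ := Ulam.exists_limit
  refine ⟨c, hc, fun ε hε => ?_⟩
  rw [ENNReal.tendsto_nhds_zero]
  intro δ hδ
  by_cases htop : δ = ⊤
  · exact Eventually.of_forall (fun n => by rw [htop]; exact le_top)
  have hδ0 : 0 < δ.toReal := ENNReal.toReal_pos hδ.ne' htop
  filter_upwards [h (ε * δ.toReal) (by positivity)] with n hn
  refine (Ulam.measure_le n (fun π => (lisLength π : ℝ) / Real.sqrt n - c) ε hε).trans ?_
  rw [← ENNReal.ofReal_toReal htop]
  apply ENNReal.ofReal_le_ofReal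
  rw [div_le_iff₀ hε]
  linarith
end
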